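/- Fix d ≥ 1 and τ ∈ [0,1]. Let A : ℝ^d → ℝ^{d×d} take values in real symmetric matrices, b : ℝ^d → ℝ^d, c : ℝ^d → ℝ, all continuous and bounded together with all their partial derivatives up to order 4, and assume a₀|p|² ≤ p·A(q)p ≤ A₀|p|² for all q, p and some 0 < a₀ ≤ A₀. For t > 0 define F_τ(t)φ(q) = ∫_{ℝ^d} g_t^{τq + (1−τ)q₁}(q − q₁) φ(q₁) dq₁ with g_t^x(z) = (4πt)^{-d/2} (det A(x))^{-1/2} e^{-t c(x)} exp( −(z − t b(x))·A(x)^{-1}(z − t b(x)) / (4t) ), F_τ(0) = id, and the differential operator L^τφ = −tr( A·Hess φ ) + ( b − 2(1−τ) div A )·∇φ + ( c + (1−τ) div b − (1−τ)² Σ_{i,j} ∂_i∂_j A_{ij} ) φ. Assume: (a) there is k ≥ 0 such that F_τ(t) maps L¹(ℝ^d) to L¹(ℝ^d) with ‖F_τ(t)φ‖_{L¹} ≤ e^{kt}‖φ‖_{L¹} for all t ≥ 0 and φ ∈ L¹(ℝ^d); (b) the densely defined operator φ ↦ −L^τφ with domain C_c^∞(ℝ^d) ⊂ L¹(ℝ^d)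 is closable and there is a strongly continuous semigroup (T_t)_{t≥0} of bounded operators on L¹(ℝ^d) whose generator equals the closure of this operator. Then for every f ∈ L¹(ℝ^d) and every t₀ > 0, (F_τ(t/n))^n f → T_t f in L¹(ℝ^d) as n → ∞, uniformly with respect to t ∈ [0, t₀]. -/

import Mathlib

open MeasureTheory Filter Topology Set RealInnerProductSpace

noncomputable section

/-- `ℝ^d` as a Euclidean space. -/
abbrev Ed (d : ℕ) := EuclideanSpace ℝ (Fin d)

/-- The Banach space `L¹(ℝ^d, ℂ)`. -/
abbrev L1sp (d : ℕ) := Lp ℂ 1 (volume : Measure (Ed d))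

/-- The `i`-th standard basis vector of `ℝ^d`. -/
def eb {d : ℕ} (i : Fin d) : Ed d := EuclideanSpace.single i (1 : ℝ)

/-- The quadratic form `p ↦ p · M p` of a matrix `M`. -/
def quadF {d : ℕ} (M : Matrix (Fin d) (Fin d) ℝ) (v : Ed d) : ℝ :=
  ∑ i, ∑ j, v i * M i j * v j

/-- The Gaussian-type kernel
`g_t^x(z) = (4πt)^{-d/2} (det A(x))^{-1/2} e^{-t c(x)} exp(−(z−t b(x))·A(x)⁻¹(z−t b(x))/(4t))`. -/
def gker {d : ℕ} (A : Ed d → Matrix (Fin d) (Fin d) ℝ) (b : Ed d → Ed d) (c : Ed d → ℝ)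
    (t : ℝ) (x z : Ed d) : ℝ :=
  (4 * Real.pi * t) ^ (-(d : ℝ) / 2) * (A x).det ^ (-(1 : ℝ) / 2) * Real.exp (-(t * c x)) *
    Real.exp (-(quadF (A x)⁻¹ (z - t • b x)) / (4 * t))

/-- The differential operator
`L^τφ = −tr(A·Hess φ) + (b − 2(1−τ) div A)·∇φ + (c + (1−τ) div b − (1−τ)² Σᵢⱼ ∂ᵢ∂ⱼAᵢⱼ)φ`. -/
def Ltau {d : ℕ} (A : Ed d → Matrix (Fin d) (Fin d) ℝ) (b : Ed d → Ed d) (c : Ed d → ℝ)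
    (τ : ℝ) (φ : Ed d → ℂ) (q : Ed d) : ℂ :=
  -(∑ i, ∑ j, ((A q i j : ℝ) : ℂ) *
      fderiv ℝ (fun x : Ed d => fderiv ℝ φ x (eb j)) q (eb i))
  + (∑ i, (((b q i - 2 * (1 - τ) *
        ∑ j, fderiv ℝ (fun x : Ed d => A x i j) q (eb j) : ℝ)) : ℂ) *
      fderiv ℝ φ q (eb i))
  + (((c q + (1 - τ) * ∑ j, fderiv ℝ (fun x : Ed d => b x j) q (eb j)
      - (1 - τ) ^ 2 * ∑ i, ∑ j,
          fderiv ℝ (fun x : Ed d => fderiv ℝ (fun y : Ed d => A y i j) x (eb j)) q (eb i)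
      : ℝ)) : ℂ) * φ q

section Chernoff

variable {X : Type*} [NormedAddCommGroup X] [NormedSpace ℝ X]

theorem semigroup_hasDerivWithinAt {T : ℝ → X →L[ℝ] X}
    (hTsemi : ∀ s t : ℝ, 0 ≤ s → 0 ≤ t → T (s + t) = (T s).comp (T t)) {f g : X}
    (hfg : Tendsto (fun t : ℝ => t⁻¹ • (T t f - f)) (𝓝[>] 0) (𝓝 g)) {s : ℝ} (hs : 0 ≤ s) :
    HasDerivWithinAt (fun r => T r f) (T s g) (Ici s) s := by
  rw [← hasDerivWithinAt_Ioi_iff_Ici, hasDerivWithinAt_iff_tendsto_slope' self_notMem_Ioi]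
  have h1 : Tendsto (fun r : ℝ => r - s) (𝓝[>] s) (𝓝[>] 0) := by
    refine tendsto_nhdsWithin_iff.2 ⟨?_, ?_⟩
    · have : Tendsto (fun r : ℝ => r - s) (𝓝 s) (𝓝 (s - s)) :=
        (continuous_sub_right s).tendsto s
      rw [sub_self] at this
      exact this.mono_left nhdsWithin_le_nhds
    · filter_upwards [self_mem_nhdsWithin] with r hr
      exact sub_pos.2 (mem_Ioi.1 hr)
  refine (((T s).continuous.tendsto g).comp (hfg.comp h1)).congr' ?_
  filter_upwards [self_mem_nhdsWithin] with r hr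
  have hr' : 0 ≤ r - s := (sub_pos.2 (mem_Ioi.1 hr)).le
  have : T r = (T s).comp (T (r - s)) := by rw [← hTsemi s (r - s) hs hr']; congr 1; ring
  simp [slope_def_module, this]

theorem norm_semigroup_sub_le {T : ℝ → X →L[ℝ] X}
    (hTsemi : ∀ s t : ℝ, 0 ≤ s → 0 ≤ t → T (s + t) = (T s).comp (T t))
    (hTcont : ∀ f : X, ContinuousOn (fun t : ℝ => T t f) (Ici 0)) {f g w : X}
    (hfg : Tendsto (fun t : ℝ => t⁻¹ • (T t f - f)) (𝓝[>] 0) (𝓝 g)) {a b ε : ℝ} (ha : 0 ≤ a)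
    (hab : a ≤ b) (hw : ∀ r ∈ Icc a b, ‖T r g - w‖ ≤ ε) :
    ‖T b f - T a f - (b - a) • w‖ ≤ ε * (b - a) := by
  have := norm_image_sub_le_of_norm_deriv_right_le_segment (f := fun r => T r f - r • w)
    (f' := fun r => T r g - w) (a := a) (b := b) (C := ε) ?_ ?_ ?_ b (right_mem_Icc.2 hab)
  · refine le_trans (le_of_eq ?_) this
    congr 1
    module
  · exact ((hTcont f).mono fun r hr => ha.trans hr.1).sub (by fun_prop)
  · intro r hr
    have h2 : HasDerivWithinAt (fun r : ℝ => r • w) w (Ici r) r := by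
      simpa using ((hasDerivAt_id r).smul_const w).hasDerivWithinAt
    exact (semigroup_hasDerivWithinAt hTsemi hfg (ha.trans hr.1)).sub h2
  · exact fun r hr => hw r ⟨hr.1, hr.2.le⟩

/-- Along the orbit of a point of the core, the semigroup can be approximated by points of the
core, in graph norm. -/
theorem exists_graph_approx {L0 : X →ₗ.[ℝ] X} (hclosable : L0.IsClosable) {T : ℝ → X →L[ℝ] X}
    (hTsemi : ∀ s t : ℝ, 0 ≤ s → 0 ≤ t → T (s + t) = (T s).comp (T t))
    (hgen_dom : ∀ f : X, f ∈ L0.closure.domain ↔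
      ∃ y : X, Tendsto (fun t : ℝ => t⁻¹ • (T t f - f)) (𝓝[>] 0) (𝓝 y))
    (hgen : ∀ f : L0.closure.domain,
      Tendsto (fun t : ℝ => t⁻¹ • (T t (f : X) - (f : X))) (𝓝[>] 0) (𝓝 (L0.closure f)))
    {f g : X} (hfg : Tendsto (fun t : ℝ => t⁻¹ • (T t f - f)) (𝓝[>] 0) (𝓝 g))
    {s : ℝ} (hs : 0 ≤ s) {η : ℝ} (hη : 0 < η) :
    ∃ v : L0.domain, ‖(v : X) - T s f‖ ≤ η ∧ ‖L0 v - T s g‖ ≤ η := by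
  have h1 : Tendsto (fun t : ℝ => t⁻¹ • (T t (T s f) - T s f)) (𝓝[>] 0) (𝓝 (T s g)) := by
    refine (((T s).continuous.tendsto g).comp hfg).congr' ?_
    filter_upwards [self_mem_nhdsWithin] with t ht
    have : (T t) (T s f) = T s (T t f) := by
      have h2 := hTsemi s t hs (le_of_lt ht)
      rw [add_comm, hTsemi t s (le_of_lt ht) hs] at h2
      exact congrArg (fun S : X →L[ℝ] X => S f) h2
    simp [this]
  have hmem : T s f ∈ L0.closure.domain := (hgen_dom _).2 ⟨_, h1⟩
  have hval : L0.closure ⟨T s f, hmem⟩ = T s g := tendsto_nhds_unique (hgen ⟨_, hmem⟩) h1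
  have h3 : (T s f, T s g) ∈ L0.closure.graph := by
    rw [← hval]
    exact LinearPMap.mem_graph L0.closure ⟨T s f, hmem⟩
  rw [← hclosable.graph_closure_eq_closure_graph] at h3
  have h4 : (T s f, T s g) ∈ closure (L0.graph : Set (X × X)) := h3
  obtain ⟨p, hp, hpd⟩ := Metric.mem_closure_iff.1 h4 η hη
  obtain ⟨v, hv1, hv2⟩ := (LinearPMap.mem_graph_iff L0).1 hp
  rw [dist_comm, Prod.dist_eq, max_lt_iff, dist_eq_norm, dist_eq_norm] at hpd
  exact ⟨v, by rw [hv1]; exact hpd.1.le, by rw [hv2]; exact hpd.2.le⟩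

theorem norm_pow_apply_le {S : X →L[ℝ] X} {c : ℝ} (hc : 0 ≤ c) (hS : ∀ f, ‖S f‖ ≤ c * ‖f‖)
    (n : ℕ) (f : X) : ‖(S ^ n) f‖ ≤ c ^ n * ‖f‖ := by
  induction n with
  | zero => simp
  | succ n ih =>
    rw [pow_succ', mul_apply_eq_comp]
    calc _ ≤ c * ‖(S ^ n) f‖ := hS _
      _ ≤ c * (c ^ n * ‖f‖) := by gcongr
      _ = _ := by ring

/-- Discrete stability: local errors `ε h` accumulate to at most `n h ε e^{k n h}`. -/
theorem norm_iterate_sub_le {S : X →L[ℝ] X} {c ε : ℝ} (hc : 1 ≤ c)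
    (hS : ∀ f, ‖S f‖ ≤ c * ‖f‖) (V : ℕ → X) (n : ℕ)
    (hV : ∀ j < n, ‖V (j + 1) - S (V j)‖ ≤ ε) :
    ‖(S ^ n) (V 0) - V n‖ ≤ n * ε * c ^ n := by
  induction n with
  | zero => simp
  | succ n ih =>
    have ih := ih fun j hj => hV j (hj.trans n.lt_succ_self)
    have h1 := hV n n.lt_succ_self
    have hε : 0 ≤ ε := (norm_nonneg _).trans h1
    rw [pow_succ', mul_apply_eq_comp]
    calc ‖S ((S ^ n) (V 0)) - V (n + 1)‖
        = ‖S ((S ^ n) (V 0) - V n) - (V (n + 1) - S (V n))‖ := by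
          congr 1; rw [map_sub]; abel
      _ ≤ ‖S ((S ^ n) (V 0) - V n)‖ + ‖V (n + 1) - S (V n)‖ := norm_sub_le _ _
      _ ≤ c * (n * ε * c ^ n) + ε * c ^ (n + 1) := by
          refine add_le_add ((hS _).trans (by gcongr)) (h1.trans ?_)
          exact le_mul_of_one_le_right hε (one_le_pow₀ hc)
      _ = _ := by push_cast; ring

/-- Piecewise linear interpolation of a sequence. -/
def interp (v : ℕ → X) (σ : ℝ) : X :=
  v ⌊σ⌋₊ + (σ - ⌊σ⌋₊) • (v (⌊σ⌋₊ + 1) - v ⌊σ⌋₊)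

theorem interp_eq (v : ℕ → X) (i : ℕ) {σ : ℝ} (h1 : i ≤ σ) (h2 : σ ≤ i + 1) :
    interp v σ = v i + (σ - i) • (v (i + 1) - v i) := by
  rcases h2.lt_or_eq with h2 | h2
  · have : ⌊σ⌋₊ = i := (Nat.floor_eq_iff ((Nat.cast_nonneg i).trans h1)).2 ⟨h1, h2⟩
    rw [interp, this]
  · have : ⌊σ⌋₊ = i + 1 := by rw [h2]; exact_mod_cast Nat.floor_natCast (i + 1)
    rw [interp, this, h2]
    push_cast
    module

theorem norm_affine_le {x y : X} {θ r : ℝ} (h0 : 0 ≤ θ) (h1 : θ ≤ 1) (hx : ‖x‖ ≤ r)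
    (hy : ‖y‖ ≤ r) : ‖x + θ • (y - x)‖ ≤ r := by
  have : x + θ • (y - x) = (1 - θ) • x + θ • y := by module
  rw [this]
  calc _ ≤ ‖(1 - θ) • x‖ + ‖θ • y‖ := norm_add_le _ _
    _ = (1 - θ) * ‖x‖ + θ * ‖y‖ := by
      rw [norm_smul, norm_smul, Real.norm_of_nonneg h0, Real.norm_of_nonneg (by linarith)]
    _ ≤ (1 - θ) * r + θ * r := by
      have : 0 ≤ 1 - θ := by linarith
      gcongr
    _ = r := by ring

theorem norm_interp_sub_le {v : ℕ → X} {i : ℕ} {σ ε : ℝ} {w : X} (h1 : i ≤ σ) (h2 : σ ≤ i + 1)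
    (hv : ‖v i - w‖ ≤ ε) (hv' : ‖v (i + 1) - w‖ ≤ ε) : ‖interp v σ - w‖ ≤ ε := by
  rw [interp_eq v i h1 h2]
  have := norm_affine_le (sub_nonneg.2 h1) (by linarith) hv hv'
  refine le_trans (le_of_eq ?_) this
  congr 1
  module

theorem norm_interp_step_le {v w : ℕ → X} {i : ℕ} {σ σ' ε : ℝ} (h1 : i ≤ σ) (h2 : σ ≤ i + 1)
    (h3 : σ ≤ σ') (h4 : σ' ≤ σ + 1)
    (hv : ∀ p ∈ ({i, i + 1} : Set ℕ), ∀ j ∈ ({i, i + 1} : Set ℕ), ‖v (j + 1) - v j - w p‖ ≤ ε) :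
    ‖interp v σ' - interp v σ - (σ' - σ) • interp w σ‖ ≤ ε * (σ' - σ) := by
  have key : ∀ j ∈ ({i, i + 1} : Set ℕ), ‖v (j + 1) - v j - interp w σ‖ ≤ ε := by
    intro j hj
    rw [norm_sub_rev]
    exact norm_interp_sub_le h1 h2 (by rw [norm_sub_rev]; exact hv i (by simp) j hj)
      (by rw [norm_sub_rev]; exact hv (i + 1) (by simp) j hj)
  rcases le_total σ' (i + 1) with h | h
  · have : interp v σ' - interp v σ - (σ' - σ) • interp w σ
        = (σ' - σ) • (v (i + 1) - v i - interp w σ) := by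
      rw [interp_eq v i h1 h2, interp_eq v i (h1.trans h3) h]
      module
    rw [this, norm_smul, Real.norm_of_nonneg (sub_nonneg.2 h3), mul_comm]
    exact mul_le_mul_of_nonneg_right (key i (by simp)) (sub_nonneg.2 h3)
  · have : interp v σ' - interp v σ - (σ' - σ) • interp w σ
        = ((i : ℝ) + 1 - σ) • (v (i + 1) - v i - interp w σ)
          + (σ' - i - 1) • (v (i + 1 + 1) - v (i + 1) - interp w σ) := by
      rw [interp_eq v i h1 h2, interp_eq v (i + 1) (by push_cast; exact h)
        (by push_cast; linarith)]
      push_cast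
      module
    rw [this]
    calc _ ≤ _ := norm_add_le _ _
      _ = ((i : ℝ) + 1 - σ) * ‖v (i + 1) - v i - interp w σ‖
          + (σ' - i - 1) * ‖v (i + 1 + 1) - v (i + 1) - interp w σ‖ := by
        rw [norm_smul, norm_smul, Real.norm_of_nonneg (by linarith),
          Real.norm_of_nonneg (by linarith)]
      _ ≤ ((i : ℝ) + 1 - σ) * ε + (σ' - i - 1) * ε := by
        have h5 : 0 ≤ (i : ℝ) + 1 - σ := by linarith
        have h6 : 0 ≤ σ' - i - 1 := by linarith
        gcongr
        · exact key i (by simp)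
        · exact key (i + 1) (by simp)
      _ = _ := by ring

/-- Chernoff's theorem on a core, along `h = t / n`, for initial values in the core. -/
theorem chernoff_core {F : ℝ → X →L[ℝ] X} {k : ℝ} (hk : 0 ≤ k)
    (hF : ∀ t : ℝ, 0 ≤ t → ∀ f, ‖F t f‖ ≤ Real.exp (k * t) * ‖f‖)
    {L0 : X →ₗ.[ℝ] X} (hclosable : L0.IsClosable)
    (hF' : ∀ v : L0.domain,
      Tendsto (fun t : ℝ => t⁻¹ • (F t (v : X) - (v : X))) (𝓝[>] 0) (𝓝 (L0 v)))
    {T : ℝ → X →L[ℝ] X}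
    (hTsemi : ∀ s t : ℝ, 0 ≤ s → 0 ≤ t → T (s + t) = (T s).comp (T t))
    (hTcont : ∀ f : X, ContinuousOn (fun t : ℝ => T t f) (Ici 0))
    (hgen_dom : ∀ f : X, f ∈ L0.closure.domain ↔
      ∃ y : X, Tendsto (fun t : ℝ => t⁻¹ • (T t f - f)) (𝓝[>] 0) (𝓝 y))
    (hgen : ∀ f : L0.closure.domain,
      Tendsto (fun t : ℝ => t⁻¹ • (T t (f : X) - (f : X))) (𝓝[>] 0) (𝓝 (L0.closure f)))
    (hF0 : F 0 = ContinuousLinearMap.id ℝ X) (hT0 : T 0 = ContinuousLinearMap.id ℝ X)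
    (f : L0.domain) {t₀ : ℝ} (ht₀ : 0 < t₀) {ε : ℝ} (hε : 0 < ε) :
    ∃ n₀ : ℕ, ∀ n ≥ n₀, ∀ t ∈ Icc 0 t₀,
      ‖((F (t / n)) ^ n) (f : X) - T t f‖ ≤ (3 + 5 * t₀) * Real.exp (k * t₀) * ε := by
  set g : X := L0 f with hg
  have hle : L0 ≤ L0.closure := L0.le_closure
  have hfg : Tendsto (fun t : ℝ => t⁻¹ • (T t (f : X) - (f : X))) (𝓝[>] 0) (𝓝 g) := by
    have h1 := hgen ⟨f, hle.1 f.2⟩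
    rwa [← hle.2 (x := f) (y := ⟨f, hle.1 f.2⟩) rfl] at h1
  -- mesh size
  have huc : ∀ w : X, ∃ δ > 0, ∀ r ∈ Icc 0 (t₀ + 3), ∀ s ∈ Icc 0 (t₀ + 3), |r - s| < δ →
      ‖T r w - T s w‖ ≤ ε := by
    intro w
    have h1 := isCompact_Icc.uniformContinuousOn_of_continuous
      ((hTcont w).mono (fun r (hr : r ∈ Icc 0 (t₀ + 3)) => hr.1))
    obtain ⟨δ, hδ, h⟩ := Metric.uniformContinuousOn_iff_le.1 h1 ε hε
    exact ⟨δ, hδ, fun r hr s hs hrs => by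
      rw [← dist_eq_norm]; exact h r hr s hs (by rw [Real.dist_eq]; exact hrs.le)⟩
  obtain ⟨δ₁, hδ₁, hu₁⟩ := huc f
  obtain ⟨δ₂, hδ₂, hu₂⟩ := huc g
  obtain ⟨δ, hδ, hδ1, hδf, hδg⟩ : ∃ δ > 0, δ ≤ 1 ∧ 2 * δ < δ₁ ∧ 2 * δ < δ₂ :=
    ⟨min 1 (min (δ₁ / 4) (δ₂ / 4)), by positivity, min_le_left _ _,
      by have := (min_le_right 1 (min (δ₁ / 4) (δ₂ / 4))).trans (min_le_left _ _); linarith,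
      by have := (min_le_right 1 (min (δ₁ / 4) (δ₂ / 4))).trans (min_le_right _ _); linarith⟩
  have happ := fun i : ℕ => exists_graph_approx hclosable hTsemi hgen_dom hgen hfg
    (s := i * δ) (by positivity) (η := min ε (ε * δ)) (by positivity)
  choose v hv1 hv2 using happ
  obtain ⟨N, hN⟩ : ∃ N : ℕ, t₀ / δ ≤ N := exists_nat_ge _
  -- uniform consistency at the nodes
  have hcons : ∀ i : ℕ, ∃ h₀ > 0, ∀ h, 0 < h → h < h₀ →
      ‖F h (v i : X) - v i - h • L0 (v i)‖ ≤ ε * h := by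
    intro i
    obtain ⟨h₀, hh₀, hh⟩ := Metric.mem_nhdsWithin_iff.1
      (Metric.tendsto_nhds.1 (hF' (v i)) ε hε)
    refine ⟨h₀, hh₀, fun h h1 h2 => ?_⟩
    have h3 : dist (h⁻¹ • (F h (v i : X) - v i)) (L0 (v i)) < ε :=
      hh (a := h) ⟨by rwa [Metric.mem_ball, Real.dist_eq, sub_zero, abs_of_pos h1], h1⟩
    rw [dist_eq_norm] at h3
    have h4 : F h (v i : X) - v i - h • L0 (v i)
        = h • (h⁻¹ • (F h (v i : X) - v i) - L0 (v i)) := by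
      rw [smul_sub, smul_smul, mul_inv_cancel₀ h1.ne', one_smul]
    rw [h4, norm_smul, Real.norm_of_nonneg h1.le, mul_comm]
    gcongr
  choose h₀ hh₀ hcons using hcons
  obtain ⟨h₁, hh₁, hh₁'⟩ : ∃ h₁ > 0, ∀ i ≤ N + 1, h₁ ≤ h₀ i := by
    refine ⟨(Finset.range (N + 2)).inf' Finset.nonempty_range_add_one h₀, ?_, fun i hi => ?_⟩
    · exact (Finset.lt_inf'_iff _).2 fun i _ => hh₀ i
    · exact Finset.inf'_le _ (Finset.mem_range.2 (by omega))
  obtain ⟨n₀, hn₀⟩ : ∃ n₀ : ℕ, t₀ / min h₁ δ < n₀ := exists_nat_gt _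
  refine ⟨n₀, fun n hn t ht => ?_⟩
  have hexp1 : 1 ≤ Real.exp (k * t₀) := Real.one_le_exp (by positivity)
  have hn0 : 0 < n := by
    have : (0 : ℝ) < n₀ := lt_of_le_of_lt (by positivity) hn₀
    have : 0 < n₀ := by exact_mod_cast this
    omega
  rcases ht.1.eq_or_lt with rfl | htpos
  · rw [zero_div, hF0, hT0, ← ContinuousLinearMap.one_def, one_pow]
    simp only [sub_self, norm_zero]
    positivity
  set h : ℝ := t / n with hh
  have hnR : (0 : ℝ) < n := by exact_mod_cast hn0
  have hhpos : 0 < h := by positivity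
  have hnh : n * h = t := by rw [hh]; field_simp
  have hhlt : h < min h₁ δ := by
    rw [hh, div_lt_iff₀ hnR]
    rw [div_lt_iff₀ (by positivity)] at hn₀
    have : (n₀ : ℝ) ≤ n := by exact_mod_cast hn
    calc t ≤ t₀ := ht.2
      _ < n₀ * min h₁ δ := hn₀
      _ ≤ n * min h₁ δ := by gcongr
      _ = _ := mul_comm _ _
  have hh1 : h < h₁ := hhlt.trans_le (min_le_left _ _)
  have hhδ : h < δ := hhlt.trans_le (min_le_right _ _)
  -- the interpolated path
  set V : ℝ → X := fun s => interp (fun i => (v i : X)) (s / δ) with hV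
  set W : ℝ → X := fun s => interp (fun i => L0 (v i)) (s / δ) with hW
  have hfloor : ∀ s, 0 ≤ s → s ≤ t₀ → ∃ i : ℕ, i ≤ N ∧ (i : ℝ) ≤ s / δ ∧ s / δ ≤ i + 1 := by
    intro s hs hs'
    refine ⟨⌊s / δ⌋₊, ?_, Nat.floor_le (by positivity), (Nat.lt_floor_add_one _).le⟩
    have : s / δ ≤ N := le_trans (by gcongr) hN
    exact_mod_cast (Nat.floor_le (by positivity)).trans this
  have hnode : ∀ i : ℕ, i ≤ N → ∀ s, s ≤ t₀ → (i : ℝ) ≤ s / δ → (i : ℝ) * δ ≤ t₀ := by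
    intro i _ s hs h1
    rw [le_div_iff₀ hδ] at h1
    linarith
  have hnear : ∀ i j : ℕ, (i : ℝ) * δ ≤ t₀ + 1 → (i = j ∨ i + 1 = j ∨ j + 1 = i) →
      ∀ r ∈ Icc ((j : ℝ) * δ) (((j + 1 : ℕ) : ℝ) * δ), r ≤ t₀ + 3 ∧ |r - i * δ| < δ₂ := by
    intro i j hi hij r hr
    have h1 := hr.1
    have h2 := hr.2
    push_cast at h2
    rcases hij with rfl | rfl | rfl
    · exact ⟨by linarith, by rw [abs_lt]; constructor <;> linarith⟩
    · push_cast at h1 h2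
      exact ⟨by linarith, by rw [abs_lt]; constructor <;> linarith⟩
    · push_cast at hi ⊢
      exact ⟨by linarith, by rw [abs_lt]; constructor <;> linarith⟩
  have hdiff : ∀ i j : ℕ, (i : ℝ) * δ ≤ t₀ + 1 → (i = j ∨ i + 1 = j ∨ j + 1 = i) →
      ‖(v (j + 1) : X) - v j - δ • L0 (v i)‖ ≤ 4 * ε * δ := by
    intro i j hi hij
    have h1 := norm_semigroup_sub_le hTsemi hTcont hfg (a := j * δ) (b := ((j + 1 : ℕ) : ℝ) * δ)
      (w := T (i * δ) g) (ε := ε) (by positivity) (by push_cast; linarith)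
      (fun r hr => hu₂ r ⟨(by positivity : (0 : ℝ) ≤ j * δ).trans hr.1, (hnear i j hi hij r hr).1⟩
        _ ⟨by positivity, by linarith⟩ (hnear i j hi hij r hr).2)
    have h2 : (((j + 1 : ℕ) : ℝ) * δ - j * δ) = δ := by push_cast; ring
    rw [h2] at h1
    have h3 := (hv1 (j + 1)).trans (min_le_right _ _)
    have h4 := (hv1 j).trans (min_le_right _ _)
    have h5 : ‖δ • (L0 (v i) - T (i * δ) g)‖ ≤ ε * δ := by
      rw [norm_smul, Real.norm_of_nonneg hδ.le, mul_comm]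
      exact mul_le_mul_of_nonneg_right ((hv2 i).trans (min_le_left _ _)) hδ.le
    have h6 : (v (j + 1) : X) - v j - δ • L0 (v i)
        = ((v (j + 1) : X) - T (((j + 1 : ℕ) : ℝ) * δ) f) - (v j - T (j * δ) f)
          + (T (((j + 1 : ℕ) : ℝ) * δ) f - T (j * δ) f - δ • T (i * δ) g)
          - δ • (L0 (v i) - T (i * δ) g) := by module
    rw [h6]
    refine (norm_sub_le _ _).trans ?_
    have h7 := norm_add_le (((v (j + 1) : X) - T (((j + 1 : ℕ) : ℝ) * δ) f) - (v j - T (j * δ) f))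
      (T (((j + 1 : ℕ) : ℝ) * δ) f - T (j * δ) f - δ • T (i * δ) g)
    have h8 := norm_sub_le ((v (j + 1) : X) - T (((j + 1 : ℕ) : ℝ) * δ) f) (v j - T (j * δ) f)
    linarith
  have hVT : ∀ s, 0 ≤ s → s ≤ t₀ → ‖V s - T s f‖ ≤ 2 * ε := by
    intro s hs hs'
    obtain ⟨i, hiN, h1, h2⟩ := hfloor s hs hs'
    have h1' := (le_div_iff₀ hδ).1 h1
    have h2' := (div_le_iff₀ hδ).1 h2
    have hn : ∀ j : ℕ, (j : ℝ) * δ ≤ t₀ + 3 → |j * δ - s| < δ₁ → ‖(v j : X) - T s f‖ ≤ 2 * ε := by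
      intro j hj hjs
      have h3 := hu₁ _ ⟨by positivity, hj⟩ s ⟨hs, by linarith⟩ hjs
      have h4 := (hv1 j).trans (min_le_left _ _)
      have h5 := norm_sub_le_norm_sub_add_norm_sub (v j : X) (T (j * δ) f) (T s f)
      linarith
    refine norm_interp_sub_le h1 h2 (hn i (by linarith) ?_) (hn (i + 1) ?_ ?_)
    · rw [abs_lt]; constructor <;> linarith
    · push_cast; linarith
    · push_cast; rw [abs_lt]; constructor <;> linarith
  have hstep : ∀ j < n, ‖V (((j + 1 : ℕ) : ℝ) * h) - F h (V (j * h))‖ ≤ 5 * ε * h := by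
    intro j hj
    have hj' : ((j + 1 : ℕ) : ℝ) ≤ n := by exact_mod_cast hj
    have hjt : ((j + 1 : ℕ) : ℝ) * h ≤ t₀ :=
      (mul_le_mul_of_nonneg_right hj' hhpos.le).trans (hnh.le.trans ht.2)
    push_cast at hjt
    obtain ⟨i, hiN, h1, h2⟩ := hfloor (j * h) (by positivity) (by linarith)
    have hi := hnode i hiN (j * h) (by linarith) h1
    have e1 := norm_interp_step_le (v := fun i => (v i : X)) (w := fun i => δ • L0 (v i)) (i := i)
      (σ := j * h / δ) (σ' := ((j + 1 : ℕ) : ℝ) * h / δ) (ε := 4 * ε * δ) h1 h2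
      (by gcongr; linarith)
      (by rw [← sub_le_iff_le_add', ← sub_div, div_le_one hδ]; push_cast; linarith)
      (by
        rintro p (rfl | rfl) l (rfl | rfl)
        · exact hdiff _ _ (by linarith) (by simp)
        · exact hdiff _ _ (by linarith) (by simp)
        · exact hdiff _ _ (by push_cast; linarith) (by simp)
        · exact hdiff _ _ (by push_cast; linarith) (by simp))
    have e2 : ((j + 1 : ℕ) : ℝ) * h / δ - j * h / δ = h / δ := by push_cast; ring
    have e3 : (h / δ) • interp (fun i => δ • L0 (v i)) (j * h / δ) = h • W (j * h) := by
      simp only [hW, interp, ← smul_sub]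
      rw [smul_comm _ δ, ← smul_add, smul_smul, div_mul_cancel₀ _ hδ.ne']
    have e4 : 4 * ε * δ * (h / δ) = 4 * ε * h := by field_simp
    rw [e2, e3, e4] at e1
    have e5 : ‖F h (V (j * h)) - V (j * h) - h • W (j * h)‖ ≤ ε * h := by
      have := norm_affine_le (sub_nonneg.2 h1) (by linarith)
        (hcons i h hhpos (hh1.trans_le (hh₁' i (by omega))))
        (hcons (i + 1) h hhpos (hh1.trans_le (hh₁' (i + 1) (by omega))))
      refine le_trans (le_of_eq ?_) this
      congr 1
      simp only [hV, hW]
      rw [interp_eq _ i h1 h2, interp_eq _ i h1 h2]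
      simp only [map_add, map_sub, map_smul]
      module
    have e6 : V (((j + 1 : ℕ) : ℝ) * h) - F h (V (j * h))
        = (V (((j + 1 : ℕ) : ℝ) * h) - V (j * h) - h • W (j * h))
          - (F h (V (j * h)) - V (j * h) - h • W (j * h)) := by abel
    rw [e6]
    refine (norm_sub_le _ _).trans ?_
    have e1' : ‖V (((j + 1 : ℕ) : ℝ) * h) - V (j * h) - h • W (j * h)‖ ≤ 4 * ε * h := e1
    linarith
  have hc := norm_iterate_sub_le (S := F h) (c := Real.exp (k * h))
    (Real.one_le_exp (by positivity)) (hF h hhpos.le) (fun j => V (j * h)) n hstep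
  have hpow : Real.exp (k * h) ^ n ≤ Real.exp (k * t₀) := by
    rw [← Real.exp_nat_mul, Real.exp_le_exp, mul_left_comm, hnh]
    exact mul_le_mul_of_nonneg_left ht.2 hk
  have hV0 : V 0 = v 0 := by
    simp only [hV]
    rw [interp_eq _ 0 (by simp) (by simp)]
    simp
  have hf0 : ‖(f : X) - V 0‖ ≤ ε := by
    have := (hv1 0).trans (min_le_left _ _)
    rw [hV0, norm_sub_rev]
    simpa [hT0] using this
  have k1 : ‖((F h) ^ n) ((f : X) - V 0)‖ ≤ Real.exp (k * t₀) * ε :=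
    (norm_pow_apply_le (Real.exp_pos _).le (hF h hhpos.le) n _).trans (by gcongr)
  have k2 : ‖((F h) ^ n) (V 0) - V t‖ ≤ 5 * t₀ * ε * Real.exp (k * t₀) := by
    simp only [Nat.cast_zero, zero_mul, hnh] at hc
    refine hc.trans ?_
    have : (n : ℝ) * (5 * ε * h) = 5 * t * ε := by rw [← hnh]; ring
    rw [this]
    have := ht.2
    gcongr
  have k3 : ‖V t - T t f‖ ≤ 2 * ε * Real.exp (k * t₀) :=
    (hVT t ht.1 ht.2).trans (le_mul_of_one_le_right (by positivity) hexp1)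
  have k4 : ((F h) ^ n) (f : X) - T t f
      = ((F h) ^ n) ((f : X) - V 0) + (((F h) ^ n) (V 0) - V t) + (V t - T t f) := by
    rw [map_sub]; abel
  rw [k4]
  refine (norm_add₃_le).trans ?_
  linarith

/-- **Chernoff's theorem** for a family that is differentiable at zero on a core. -/
theorem chernoff [CompleteSpace X] {F : ℝ → X →L[ℝ] X} {k : ℝ} (hk : 0 ≤ k)
    (hF0 : F 0 = ContinuousLinearMap.id ℝ X)
    (hF : ∀ t : ℝ, 0 ≤ t → ∀ f, ‖F t f‖ ≤ Real.exp (k * t) * ‖f‖)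
    {L0 : X →ₗ.[ℝ] X} (hclosable : L0.IsClosable) (hdense : Dense (L0.domain : Set X))
    (hF' : ∀ v : L0.domain,
      Tendsto (fun t : ℝ => t⁻¹ • (F t (v : X) - (v : X))) (𝓝[>] 0) (𝓝 (L0 v)))
    {T : ℝ → X →L[ℝ] X} (hT0 : T 0 = ContinuousLinearMap.id ℝ X)
    (hTsemi : ∀ s t : ℝ, 0 ≤ s → 0 ≤ t → T (s + t) = (T s).comp (T t))
    (hTcont : ∀ f : X, ContinuousOn (fun t : ℝ => T t f) (Ici 0))
    (hgen_dom : ∀ f : X, f ∈ L0.closure.domain ↔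
      ∃ y : X, Tendsto (fun t : ℝ => t⁻¹ • (T t f - f)) (𝓝[>] 0) (𝓝 y))
    (hgen : ∀ f : L0.closure.domain,
      Tendsto (fun t : ℝ => t⁻¹ • (T t (f : X) - (f : X))) (𝓝[>] 0) (𝓝 (L0.closure f)))
    (f : X) {t₀ : ℝ} (ht₀ : 0 < t₀) :
    TendstoUniformlyOn (fun (n : ℕ) (t : ℝ) => ((F (t / n)) ^ n) f) (fun t : ℝ => T t f) atTop
      (Icc 0 t₀) := by
  obtain ⟨M, hM⟩ : ∃ M, ∀ t : Icc 0 t₀, ‖T t‖ ≤ M := by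
    refine banach_steinhaus fun x => ?_
    obtain ⟨C, hC⟩ := isCompact_Icc.exists_bound_of_continuousOn
      ((hTcont x).mono (fun r (hr : r ∈ Icc 0 t₀) => hr.1))
    exact ⟨C, fun t => hC t t.2⟩
  have hM0 : 0 ≤ M := (norm_nonneg _).trans (hM ⟨0, left_mem_Icc.2 ht₀.le⟩)
  rw [Metric.tendstoUniformlyOn_iff]
  intro ε hε
  set η : ℝ := ε / (2 * (Real.exp (k * t₀) + M + 1)) with hη
  have hEpos := Real.exp_pos (k * t₀)
  have hη0 : 0 < η := by positivity
  obtain ⟨g, hg, hgf⟩ := Metric.mem_closure_iff.1 (hdense f) η hη0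
  rw [dist_eq_norm] at hgf
  obtain ⟨n₀, hn₀⟩ := chernoff_core hk hF hclosable hF' hTsemi hTcont hgen_dom hgen hF0 hT0
    ⟨g, hg⟩ ht₀ (ε := ε / (4 * ((3 + 5 * t₀) * Real.exp (k * t₀)))) (by positivity)
  filter_upwards [eventually_ge_atTop (max n₀ 1)] with n hn t ht
  have hn1 : 1 ≤ n := (le_max_right _ _).trans hn
  have hnR : (0 : ℝ) < n := by exact_mod_cast hn1
  have k1 := hn₀ n ((le_max_left _ _).trans hn) t ht
  have k1' : (3 + 5 * t₀) * Real.exp (k * t₀) * (ε / (4 * ((3 + 5 * t₀) * Real.exp (k * t₀))))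
      = ε / 4 := by field_simp
  rw [k1'] at k1
  have hpow : Real.exp (k * (t / n)) ^ n ≤ Real.exp (k * t₀) := by
    rw [← Real.exp_nat_mul, Real.exp_le_exp]
    have : (n : ℝ) * (k * (t / n)) = k * t := by field_simp
    rw [this]
    exact mul_le_mul_of_nonneg_left ht.2 hk
  have k2 : ‖((F (t / n)) ^ n) (f - g)‖ ≤ Real.exp (k * t₀) * η :=
    (norm_pow_apply_le (Real.exp_pos _).le (hF _ (div_nonneg ht.1 hnR.le)) n _).trans
      (by gcongr)
  have k3 : ‖T t (f - g)‖ ≤ M * η :=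
    ((T t).le_opNorm _).trans (mul_le_mul (hM ⟨t, ht⟩) hgf.le (norm_nonneg _) hM0)
  have k4 : Real.exp (k * t₀) * η + M * η ≤ ε / 2 := by
    have : (Real.exp (k * t₀) + M + 1) * η = ε / 2 := by rw [hη]; field_simp
    nlinarith
  rw [dist_comm, dist_eq_norm]
  have k5 : ((F (t / n)) ^ n) f - T t f
      = ((F (t / n)) ^ n) (f - g) + (((F (t / n)) ^ n) g - T t g) - T t (f - g) := by
    rw [map_sub, map_sub]; abel
  rw [k5]
  have k6 := norm_sub_le (((F (t / n)) ^ n) (f - g) + (((F (t / n)) ^ n) g - T t g)) (T t (f - g))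
  have k7 := norm_add_le (((F (t / n)) ^ n) (f - g)) (((F (t / n)) ^ n) g - T t g)
  have k8 : ‖((F (t / n)) ^ n) g - T t g‖ ≤ ε / 4 := k1
  linarith

end Chernoff

section PolyBounds

theorem exists_one_add_pow_le_exp (m : ℕ) {a : ℝ} (ha : 0 < a) :
    ∃ C : ℝ, 0 < C ∧ ∀ r : ℝ, 0 ≤ r → (1 + r) ^ m ≤ C * Real.exp (a * r ^ 2) := by
  refine ⟨m.factorial * Real.exp (1 + 1 / (4 * a)), by positivity, fun r hr => ?_⟩
  have h1 := Real.pow_div_factorial_le_exp (1 + r) (by positivity) m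
  rw [div_le_iff₀ (by positivity)] at h1
  refine h1.trans ?_
  rw [mul_comm, mul_assoc, ← Real.exp_add]
  have h2 : 1 + r ≤ 1 + 1 / (4 * a) + a * r ^ 2 := by
    have : 0 ≤ a * (r - 1 / (2 * a)) ^ 2 := by positivity
    have h3 : a * (r - 1 / (2 * a)) ^ 2 = a * r ^ 2 - r + 1 / (4 * a) := by field_simp; ring
    linarith
  gcongr

variable {X Y V : Type*} [NormedAddCommGroup X] [NormedSpace ℝ X] [NormedAddCommGroup Y]
  [NormedSpace ℝ Y] [NormedAddCommGroup V] [NormedSpace ℝ V]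

/-- `u` is jointly `C²`, and its derivatives in the first variable, of order at most two, grow at
most polynomially in the second variable, uniformly on `S`. -/
def PolyBdd (S : Set X) (u : X → Y → V) : Prop :=
  ContDiff ℝ 2 (Function.uncurry u) ∧ ∃ (C : ℝ) (m : ℕ), 0 ≤ C ∧ ∀ x ∈ S, ∀ y, ∀ k ≤ 2,
    ‖iteratedFDeriv ℝ k (fun x => u x y) x‖ ≤ C * (1 + ‖y‖) ^ m

/-- `u` is jointly `C²`, and its derivatives in the first variable, of order at most two, have
Gaussian decay in the second variable, uniformly on `S`. -/
def GaussBdd (S : Set X) (u : X → Y → V) : Prop :=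
  ContDiff ℝ 2 (Function.uncurry u) ∧ ∃ C a : ℝ, 0 < C ∧ 0 < a ∧ ∀ x ∈ S, ∀ y, ∀ k ≤ 2,
    ‖iteratedFDeriv ℝ k (fun x => u x y) x‖ ≤ C * Real.exp (-(a * ‖y‖ ^ 2))

theorem ContDiff.slice_left {n : WithTop ℕ∞} {u : X → Y → V}
    (hu : ContDiff ℝ n (Function.uncurry u)) (y : Y) : ContDiff ℝ n fun x => u x y :=
  hu.comp (contDiff_id.prodMk contDiff_const)

theorem PolyBdd.of_bdd {S : Set X} {p : X → V} (hp : ContDiff ℝ 2 p)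
    (hb : ∀ k ≤ 2, ∃ C, ∀ x ∈ S, ‖iteratedFDeriv ℝ k p x‖ ≤ C) :
    PolyBdd S (fun x (_ : Y) => p x) := by
  choose! C hC using hb
  refine ⟨hp.comp contDiff_fst, ∑ k ∈ Finset.range 3, |C k|, 0,
    Finset.sum_nonneg fun _ _ => abs_nonneg _, fun x hx y k hk => ?_⟩
  rw [pow_zero, mul_one]
  exact ((hC k hk x hx).trans (le_abs_self _)).trans
    (Finset.single_le_sum (f := fun k => |C k|) (fun _ _ => abs_nonneg _)
      (Finset.mem_range.2 (by omega)))

theorem PolyBdd.of_right {S : Set X} {p : Y → V} (hp : ContDiff ℝ 2 p) {C : ℝ} {m : ℕ}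
    (hb : ∀ y, ‖p y‖ ≤ C * (1 + ‖y‖) ^ m) : PolyBdd S (fun (_ : X) y => p y) := by
  have hC : 0 ≤ C := by simpa using (norm_nonneg _).trans (hb 0)
  refine ⟨hp.comp contDiff_snd, C, m, hC, fun x _ y k _ => ?_⟩
  rcases k with _ | k
  · simpa using hb y
  · rw [iteratedFDeriv_const_of_ne (Nat.succ_ne_zero k)]
    simp only [Pi.zero_apply, norm_zero]
    positivity

theorem PolyBdd.exists_le_le {S : Set X} {u v : X → Y → ℝ} (hu : PolyBdd S u)
    (hv : PolyBdd S v) : ∃ (C : ℝ) (m : ℕ), 0 ≤ C ∧ ∀ x ∈ S, ∀ y, ∀ k ≤ 2,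
    ‖iteratedFDeriv ℝ k (fun x => u x y) x‖ ≤ C * (1 + ‖y‖) ^ m ∧
    ‖iteratedFDeriv ℝ k (fun x => v x y) x‖ ≤ C * (1 + ‖y‖) ^ m := by
  obtain ⟨-, C, m, hC, h⟩ := hu
  obtain ⟨-, C', m', hC', h'⟩ := hv
  refine ⟨C + C', m + m', by positivity, fun x hx y k hk => ⟨?_, ?_⟩⟩
  · refine (h x hx y k hk).trans ?_
    have : 1 ≤ 1 + ‖y‖ := by linarith [norm_nonneg y]
    gcongr
    · linarith
    · omega
  · refine (h' x hx y k hk).trans ?_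
    have : 1 ≤ 1 + ‖y‖ := by linarith [norm_nonneg y]
    gcongr
    · linarith
    · omega

theorem PolyBdd.add {S : Set X} {u v : X → Y → ℝ} (hu : PolyBdd S u) (hv : PolyBdd S v) :
    PolyBdd S (fun x y => u x y + v x y) := by
  obtain ⟨C, m, hC, h⟩ := hu.exists_le_le hv
  refine ⟨hu.1.add hv.1, 2 * C, m, by positivity, fun x hx y k hk => ?_⟩
  have hk' : ((k : ℕ) : WithTop ℕ∞) ≤ 2 := by exact_mod_cast hk
  have h1 := fun_iteratedFDeriv_add_apply (x := x) (i := k)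
    (((ContDiff.slice_left hu.1 y).contDiffAt (x := x)).of_le hk')
    (((ContDiff.slice_left hv.1 y).contDiffAt (x := x)).of_le hk')
  rw [h1]
  refine (norm_add_le _ _).trans ?_
  have := h x hx y k hk
  linarith [this.1, this.2]

theorem PolyBdd.mul {S : Set X} {u v : X → Y → ℝ} (hu : PolyBdd S u) (hv : PolyBdd S v) :
    PolyBdd S (fun x y => u x y * v x y) := by
  obtain ⟨C, m, hC, h⟩ := hu.exists_le_le hv
  refine ⟨hu.1.mul hv.1, 4 * C ^ 2, 2 * m, by positivity, fun x hx y k hk => ?_⟩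
  have hk' : ((k : ℕ) : WithTop ℕ∞) ≤ 2 := by exact_mod_cast hk
  refine (norm_iteratedFDeriv_mul_le (ContDiff.slice_left hu.1 y) (ContDiff.slice_left hv.1 y)
    x hk').trans ?_
  calc _ ≤ ∑ i ∈ Finset.range (k + 1), (k.choose i : ℝ) * (C * (1 + ‖y‖) ^ m) *
        (C * (1 + ‖y‖) ^ m) := by
        refine Finset.sum_le_sum fun i hi => ?_
        have hi' := Finset.mem_range.1 hi
        gcongr
        · exact (h x hx y i (by omega)).1
        · exact (h x hx y (k - i) (by omega)).2
    _ = (2 : ℝ) ^ k * ((C * (1 + ‖y‖) ^ m) * (C * (1 + ‖y‖) ^ m)) := by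
        simp_rw [mul_assoc]
        rw [← Finset.sum_mul]
        congr 1
        exact_mod_cast Nat.sum_range_choose k
    _ ≤ (2 : ℝ) ^ 2 * ((C * (1 + ‖y‖) ^ m) * (C * (1 + ‖y‖) ^ m)) := by
        gcongr
        norm_num
    _ = _ := by ring

theorem PolyBdd.const (S : Set X) (r : ℝ) : PolyBdd S (fun (_ : X) (_ : Y) => r) :=
  PolyBdd.of_right (C := |r|) (m := 0) contDiff_const (by simp)

theorem PolyBdd.sum {S : Set X} {ι : Type*} (s : Finset ι) {u : ι → X → Y → ℝ}
    (hu : ∀ i, PolyBdd S (u i)) : PolyBdd S (fun x y => ∑ i ∈ s, u i x y) := by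
  classical
  induction s using Finset.induction_on with
  | empty => simpa using PolyBdd.const S (0 : ℝ)
  | insert i s hi ih =>
    simp_rw [Finset.sum_insert hi]
    exact (hu i).add ih

/-- Post-composition with a function that is `C²` near the compact closure of the range. -/
theorem PolyBdd.of_comp {S : Set X} {p : X → V} {g : V → ℝ} {U K : Set V} (hU : IsOpen U)
    (hK : IsCompact K) (hKU : K ⊆ U) (hg : ContDiffOn ℝ 2 g U) (hp : ContDiff ℝ 2 p)
    (hb : ∀ k ≤ 2, ∃ C, ∀ x ∈ S, ‖iteratedFDeriv ℝ k p x‖ ≤ C) (hpU : ∀ x, p x ∈ U)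
    (hpK : ∀ x ∈ S, p x ∈ K) : PolyBdd S (fun x (_ : Y) => g (p x)) := by
  have hgp : ContDiff ℝ 2 (fun x => g (p x)) := hg.comp_contDiff hp hpU
  refine PolyBdd.of_bdd hgp fun k hk => ?_
  have hk' : ((k : ℕ) : WithTop ℕ∞) ≤ 2 := by exact_mod_cast hk
  have hgb : ∀ i ≤ 2, ∃ C, ∀ v ∈ K, ‖iteratedFDerivWithin ℝ i g U v‖ ≤ C := fun i hi =>
    hK.exists_bound_of_continuousOn ((hg.continuousOn_iteratedFDerivWithin
      (by exact_mod_cast hi) hU.uniqueDiffOn).mono hKU)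
  choose! C hC using hgb
  choose! D hD using hb
  refine ⟨k.factorial * (∑ i ∈ Finset.range 3, |C i|) *
    (1 + ∑ i ∈ Finset.range 3, |D i|) ^ k, fun x hx => ?_⟩
  have h1 := norm_iteratedFDerivWithin_comp_le (n := k) (s := univ) (t := U) (x := x) hg
    hp.contDiffOn hk' hU.uniqueDiffOn uniqueDiffOn_univ (fun x _ => hpU x) (mem_univ x)
    (C := ∑ i ∈ Finset.range 3, |C i|) (D := 1 + ∑ i ∈ Finset.range 3, |D i|) ?_ ?_
  · rwa [iteratedFDerivWithin_univ] at h1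
  · intro i hi
    exact ((hC i (hi.trans hk) _ (hpK x hx)).trans (le_abs_self _)).trans
      (Finset.single_le_sum (f := fun k => |C k|) (fun _ _ => abs_nonneg _)
        (Finset.mem_range.2 (by omega)))
  · intro i hi0 hi
    rw [iteratedFDerivWithin_univ]
    have h2 : ‖iteratedFDeriv ℝ i p x‖ ≤ ∑ i ∈ Finset.range 3, |D i| :=
      ((hD i (hi.trans hk) _ hx).trans (le_abs_self _)).trans
        (Finset.single_le_sum (f := fun k => |D k|) (fun _ _ => abs_nonneg _)
        (Finset.mem_range.2 (by omega)))
    have h3 : 0 ≤ ∑ i ∈ Finset.range 3, |D i| := Finset.sum_nonneg fun _ _ => abs_nonneg _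
    calc _ ≤ 1 + ∑ i ∈ Finset.range 3, |D i| := by linarith
      _ ≤ _ := le_self_pow₀ (by linarith) (by omega)

theorem PolyBdd.exp {S : Set X} {u : X → Y → ℝ} (hu : PolyBdd S u) {C₀ a : ℝ} (ha : 0 < a)
    (hle : ∀ x ∈ S, ∀ y, u x y ≤ C₀ - a * ‖y‖ ^ 2) : GaussBdd S (fun x y => Real.exp (u x y)) := by
  obtain ⟨hc, C, m, hC, h⟩ := hu
  obtain ⟨B, hB, hB'⟩ := exists_one_add_pow_le_exp (2 * m) (half_pos ha)
  refine ⟨Real.contDiff_exp.comp hc, 2 * Real.exp C₀ * (1 + C) ^ 2 * B, a / 2, by positivity,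
    by positivity, fun x hx y k hk => ?_⟩
  have hk' : ((k : ℕ) : WithTop ℕ∞) ≤ 2 := by exact_mod_cast hk
  have hy : 1 ≤ (1 + ‖y‖) ^ m := one_le_pow₀ (by linarith [norm_nonneg y])
  have hD : 1 ≤ (1 + C) * (1 + ‖y‖) ^ m := one_le_mul_of_one_le_of_one_le (by linarith) hy
  have h1 := norm_iteratedFDeriv_comp_le (n := k) Real.contDiff_exp (ContDiff.slice_left hc y)
    hk' x (C := Real.exp (u x y)) (D := (1 + C) * (1 + ‖y‖) ^ m) ?_ ?_
  · refine h1.trans ?_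
    have h2 : (k.factorial : ℝ) ≤ 2 := by
      have : k.factorial ≤ Nat.factorial 2 := Nat.factorial_le hk
      exact_mod_cast this
    calc _ ≤ 2 * Real.exp (C₀ - a * ‖y‖ ^ 2) * ((1 + C) * (1 + ‖y‖) ^ m) ^ 2 := by
          gcongr
          exact hle x hx y
      _ = 2 * (Real.exp C₀ * Real.exp (-(a * ‖y‖ ^ 2))) * ((1 + C) ^ 2 * (1 + ‖y‖) ^ (2 * m)) := by
          rw [← Real.exp_add, mul_pow, ← pow_mul, mul_comm m 2]
          ring_nf
      _ ≤ 2 * (Real.exp C₀ * Real.exp (-(a * ‖y‖ ^ 2))) *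
            ((1 + C) ^ 2 * (B * Real.exp (a / 2 * ‖y‖ ^ 2))) := by
          gcongr
          exact hB' _ (norm_nonneg y)
      _ = 2 * Real.exp C₀ * (1 + C) ^ 2 * B *
            (Real.exp (-(a * ‖y‖ ^ 2)) * Real.exp (a / 2 * ‖y‖ ^ 2)) := by ring
      _ = _ := by rw [← Real.exp_add]; ring_nf
  · intro i _
    rw [norm_iteratedFDeriv_eq_norm_iteratedDeriv, iteratedDeriv_eq_iterate, Real.iter_deriv_exp,
      Real.norm_of_nonneg (Real.exp_pos _).le]
  · intro i hi0 hi
    refine (h x hx y i (hi.trans hk)).trans ?_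
    calc _ ≤ (1 + C) * (1 + ‖y‖) ^ m := by gcongr; linarith
      _ ≤ _ := le_self_pow₀ hD (by omega)

end PolyBounds

section GaussBounds

variable {X Y V : Type*} [NormedAddCommGroup X] [NormedSpace ℝ X] [NormedAddCommGroup Y]
  [NormedSpace ℝ Y] [NormedAddCommGroup V] [NormedSpace ℝ V]

theorem hasDerivAt_comp_line {f : X → V} {p v : X} {s : ℝ}
    (hf : DifferentiableAt ℝ f (p + s • v)) :
    HasDerivAt (fun r : ℝ => f (p + r • v)) (fderiv ℝ f (p + s • v) v) s := by
  have h : HasDerivAt (fun r : ℝ => p + r • v) v s := by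
    simpa using ((hasDerivAt_id s).smul_const v).const_add p
  exact hf.hasFDerivAt.comp_hasDerivAt s h

theorem hasDerivAt_fderiv_comp_line {f : X → V} (hf : ContDiff ℝ 2 f) (p v w : X) (s : ℝ) :
    HasDerivAt (fun r : ℝ => fderiv ℝ f (p + r • v) w)
      (fderiv ℝ (fderiv ℝ f) (p + s • v) v w) s := by
  have h1 : DifferentiableAt ℝ (fderiv ℝ f) (p + s • v) :=
    ((hf.fderiv_right (m := 1) (by norm_num)).differentiable (by norm_num)) _
  simpa using (hasDerivAt_comp_line h1).clm_apply (hasDerivAt_const s w)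

theorem GaussBdd.weight {S : Set X} {u : X → Y → ℝ} (hu : GaussBdd S u) {P : Y → ℝ}
    (hP : ContDiff ℝ 2 P) {B : ℝ} {m : ℕ} (hB : ∀ y, |P y| ≤ B * (1 + ‖y‖) ^ m) :
    GaussBdd S (fun x y => P y * u x y) := by
  obtain ⟨hc, C, a, hC, ha, h⟩ := hu
  obtain ⟨D, hD, hD'⟩ := exists_one_add_pow_le_exp m (half_pos ha)
  have hB0 : 0 ≤ B := by simpa using (abs_nonneg _).trans (hB 0)
  refine ⟨(hP.comp contDiff_snd).mul hc, (B + 1) * D * C, a / 2, by positivity, by positivity,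
    fun x hx y k hk => ?_⟩
  have hk' : ((k : ℕ) : WithTop ℕ∞) ≤ 2 := by exact_mod_cast hk
  have h1 := iteratedFDeriv_const_smul_apply' (a := P y) (x := x) (i := k)
    (((ContDiff.slice_left hc y).contDiffAt (x := x)).of_le hk')
  simp only [smul_eq_mul] at h1
  rw [h1, norm_smul]
  calc _ ≤ (B * (D * Real.exp (a / 2 * ‖y‖ ^ 2))) * (C * Real.exp (-(a * ‖y‖ ^ 2))) := by
        gcongr
        · exact (hB y).trans (by gcongr; exact hD' _ (norm_nonneg y))
        · exact h x hx y k hk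
    _ = B * D * C * (Real.exp (a / 2 * ‖y‖ ^ 2) * Real.exp (-(a * ‖y‖ ^ 2))) := by ring
    _ = B * D * C * Real.exp (-(a / 2 * ‖y‖ ^ 2)) := by rw [← Real.exp_add]; ring_nf
    _ ≤ _ := by gcongr; linarith

theorem GaussBdd.norm_le {S : Set X} {u : X → Y → V} (hu : GaussBdd S u) :
    ∃ C a : ℝ, 0 < C ∧ 0 < a ∧ ∀ x ∈ S, ∀ y,
      ‖u x y‖ ≤ C * Real.exp (-(a * ‖y‖ ^ 2)) ∧
      ‖fderiv ℝ (fun x => u x y) x‖ ≤ C * Real.exp (-(a * ‖y‖ ^ 2)) ∧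
      ‖fderiv ℝ (fderiv ℝ (fun x => u x y)) x‖ ≤ C * Real.exp (-(a * ‖y‖ ^ 2)) := by
  obtain ⟨-, C, a, hC, ha, h⟩ := hu
  refine ⟨C, a, hC, ha, fun x hx y => ⟨?_, ?_, ?_⟩⟩
  · simpa using h x hx y 0 (by norm_num)
  · simpa [norm_iteratedFDeriv_one] using h x hx y 1 (by norm_num)
  · have := h x hx y 2 (by norm_num)
    rwa [← norm_iteratedFDeriv_fderiv, norm_iteratedFDeriv_one] at this

theorem contDiff_fderiv_slice {u : X → Y → V} (hu : ContDiff ℝ 2 (Function.uncurry u)) :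
    ContDiff ℝ 1 (fun p : X × Y => fderiv ℝ (fun x => u x p.2) p.1) := by
  refine ContDiff.fderiv (m := 2) (f := fun (p : X × Y) x => u x p.2) ?_ contDiff_fst
    (by norm_num)
  exact hu.comp (contDiff_snd.prodMk (contDiff_snd.comp contDiff_fst))

theorem continuous_fderiv_fderiv_slice {u : X → Y → V}
    (hu : ContDiff ℝ 2 (Function.uncurry u)) :
    Continuous (fun p : X × Y => fderiv ℝ (fderiv ℝ (fun x => u x p.2)) p.1) := by
  have h := contDiff_fderiv_slice hu
  have h2 : ContDiff ℝ 0 (fun p : X × Y => fderiv ℝ (fderiv ℝ (fun x => u x p.2)) p.1) := by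
    refine ContDiff.fderiv (m := 1) (f := fun (p : X × Y) x => fderiv ℝ (fun x => u x p.2) x) ?_
      contDiff_fst (by norm_num)
    exact h.comp (contDiff_snd.prodMk (contDiff_snd.comp contDiff_fst))
  exact h2.continuous

variable [FiniteDimensional ℝ Y] [MeasurableSpace Y] [BorelSpace Y]

theorem integrable_one_add_pow_inv (μ : Measure Y) [μ.IsAddHaarMeasure] :
    Integrable (fun y : Y => ((1 + ‖y‖) ^ (Module.finrank ℝ Y + 1))⁻¹) μ := by
  have h := integrable_one_add_norm (E := Y) (μ := μ) (r := (Module.finrank ℝ Y + 1 : ℕ))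
    (by push_cast; linarith)
  refine h.congr (Eventually.of_forall fun y => ?_)
  have : 0 ≤ 1 + ‖y‖ := by positivity
  simp only [Real.rpow_neg this, Real.rpow_natCast]

theorem integrable_exp_neg_mul_sq_norm (μ : Measure Y) [μ.IsAddHaarMeasure] {a : ℝ} (ha : 0 < a) :
    Integrable (fun y : Y => Real.exp (-(a * ‖y‖ ^ 2))) μ := by
  obtain ⟨D, hD, hD'⟩ := exists_one_add_pow_le_exp (Module.finrank ℝ Y + 1) ha
  refine ((integrable_one_add_pow_inv μ).const_mul D).mono'
    (by fun_prop : Continuous fun y : Y => Real.exp (-(a * ‖y‖ ^ 2))).aestronglyMeasurable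
    (Eventually.of_forall fun y => ?_)
  rw [Real.norm_of_nonneg (Real.exp_pos _).le, Real.exp_neg]
  have h := hD' _ (norm_nonneg y)
  rw [inv_le_iff_one_le_mul₀ (Real.exp_pos _), mul_right_comm, ← div_eq_mul_inv, le_div_iff₀
    (by positivity)]
  linarith

variable {μ : Measure Y} [μ.IsAddHaarMeasure]

theorem integrable_of_le_gauss {W : Type*} [NormedAddCommGroup W] {f : Y → W}
    (hf : Continuous f) {C a : ℝ} (ha : 0 < a)
    (h : ∀ y, ‖f y‖ ≤ C * Real.exp (-(a * ‖y‖ ^ 2))) : Integrable f μ :=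
  ((integrable_exp_neg_mul_sq_norm μ ha).const_mul C).mono' hf.aestronglyMeasurable
    (Eventually.of_forall h)

theorem GaussBdd.hasDerivAt_integral {S : Set X} {u : X → Y → ℝ} (hu : GaussBdd S u) {x v : X}
    (hS : ∀ r : ℝ, |r| < 1 → x + r • v ∈ S) :
    Integrable (fun y => fderiv ℝ (fun x => u x y) x v) μ ∧
    HasDerivAt (fun r : ℝ => ∫ y, u (x + r • v) y ∂μ)
      (∫ y, fderiv ℝ (fun x => u x y) x v ∂μ) 0 := by
  obtain ⟨C, a, hC, ha, h⟩ := hu.norm_le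
  have hx : ∀ r : ℝ, Continuous (fun y => u (x + r • v) y) := fun r =>
    hu.1.continuous.comp (Continuous.prodMk_right _)
  have key := hasDerivAt_integral_of_dominated_loc_of_deriv_le (μ := μ) (𝕜 := ℝ)
    (F := fun r y => u (x + r • v) y) (x₀ := 0) (s := Metric.ball 0 1)
    (F' := fun r y => fderiv ℝ (fun x => u x y) (x + r • v) v)
    (bound := fun y => C * Real.exp (-(a * ‖y‖ ^ 2)) * ‖v‖) (Metric.ball_mem_nhds _ one_pos)
    (Eventually.of_forall fun r => (hx r).aestronglyMeasurable)
    (integrable_of_le_gauss (hx 0) ha fun y => (h _ (hS 0 (by simp)) y).1) ?_ ?_ ?_ ?_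
  · simpa using key
  · refine Continuous.aestronglyMeasurable ?_
    exact ((contDiff_fderiv_slice hu.1).continuous.comp (Continuous.prodMk_right _)).clm_apply
      continuous_const
  · refine Eventually.of_forall fun y r hr => ?_
    have hr' : |r| < 1 := by simpa using hr
    exact (ContinuousLinearMap.le_opNorm _ _).trans
      (mul_le_mul_of_nonneg_right (h _ (hS r hr') y).2.1 (norm_nonneg _))
  · exact ((integrable_exp_neg_mul_sq_norm μ ha).const_mul C).mul_const _
  · exact Eventually.of_forall fun y r _ => hasDerivAt_comp_line
      (((ContDiff.slice_left hu.1 y).differentiable (by norm_num)) _)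

theorem GaussBdd.hasDerivAt_integral_fderiv {S : Set X} {u : X → Y → ℝ} (hu : GaussBdd S u)
    {x v : X} (w : X) (hS : ∀ r : ℝ, |r| < 1 → x + r • v ∈ S) :
    Integrable (fun y => fderiv ℝ (fderiv ℝ (fun x => u x y)) x v w) μ ∧
    HasDerivAt (fun r : ℝ => ∫ y, fderiv ℝ (fun x => u x y) (x + r • v) w ∂μ)
      (∫ y, fderiv ℝ (fderiv ℝ (fun x => u x y)) x v w ∂μ) 0 := by
  obtain ⟨C, a, hC, ha, h⟩ := hu.norm_le
  have hx : ∀ r : ℝ, Continuous (fun y => fderiv ℝ (fun x => u x y) (x + r • v) w) := fun r =>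
    ((contDiff_fderiv_slice hu.1).continuous.comp (Continuous.prodMk_right _)).clm_apply
      continuous_const
  have key := hasDerivAt_integral_of_dominated_loc_of_deriv_le (μ := μ) (𝕜 := ℝ)
    (F := fun r y => fderiv ℝ (fun x => u x y) (x + r • v) w) (x₀ := 0) (s := Metric.ball 0 1)
    (F' := fun r y => fderiv ℝ (fderiv ℝ (fun x => u x y)) (x + r • v) v w)
    (bound := fun y => C * Real.exp (-(a * ‖y‖ ^ 2)) * (‖v‖ * ‖w‖))
    (Metric.ball_mem_nhds _ one_pos)
    (Eventually.of_forall fun r => (hx r).aestronglyMeasurable)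
    (integrable_of_le_gauss (C := C * ‖w‖) (hx 0) ha fun y => ?_) ?_ ?_ ?_ ?_
  · simpa using key
  · refine (ContinuousLinearMap.le_opNorm _ _).trans ((mul_le_mul_of_nonneg_right
      (h _ (hS 0 (by simp)) y).2.1 (norm_nonneg _)).trans (le_of_eq (by ring)))
  · refine Continuous.aestronglyMeasurable ?_
    exact (((continuous_fderiv_fderiv_slice hu.1).comp (Continuous.prodMk_right _)).clm_apply
      continuous_const).clm_apply continuous_const
  · refine Eventually.of_forall fun y r hr => ?_
    have hr' : |r| < 1 := by simpa using hr
    refine (ContinuousLinearMap.le_opNorm₂ _ _ _).trans ?_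
    rw [mul_assoc]
    exact mul_le_mul_of_nonneg_right (h _ (hS r hr') y).2.2 (by positivity)
  · exact ((integrable_exp_neg_mul_sq_norm μ ha).const_mul C).mul_const _
  · exact Eventually.of_forall fun y r _ =>
      hasDerivAt_fderiv_comp_line (ContDiff.slice_left hu.1 y) x v w r

end GaussBounds

section Taylor

theorem norm_taylor_two_le {W : Type*} [NormedAddCommGroup W] [NormedSpace ℝ W]
    {h h1 h2 : ℝ → W} (hh : ∀ r, HasDerivAt h (h1 r) r) (hh1 : ∀ r, HasDerivAt h1 (h2 r) r)
    {s ε : ℝ} (hs : 0 ≤ s) (hε : ∀ r ∈ Icc 0 s, ‖h2 r - h2 0‖ ≤ ε) :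
    ‖h s - h 0 - s • h1 0 - (s ^ 2 / 2) • h2 0‖ ≤ ε * s ^ 2 := by
  have hε0 : 0 ≤ ε := (norm_nonneg _).trans (hε 0 (left_mem_Icc.2 hs))
  have hg : ∀ r, HasDerivAt (fun r => h1 r - h1 0 - r • h2 0) (h2 r - h2 0) r := fun r =>
    (((hh1 r).sub_const (h1 0)).sub ((hasDerivAt_id r).smul_const (h2 0))).congr_deriv (by simp)
  have hf : ∀ r, HasDerivAt (fun r => h r - h 0 - r • h1 0 - (r ^ 2 / 2) • h2 0)
      (h1 r - h1 0 - r • h2 0) r := fun r => by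
    have e : HasDerivAt (fun r : ℝ => r ^ 2 / 2) r r := by
      simpa using ((hasDerivAt_id r).pow 2).div_const 2
    exact ((((hh r).sub_const (h 0)).sub ((hasDerivAt_id r).smul_const (h1 0))).sub
      (e.smul_const (h2 0))).congr_deriv (by simp)
  have b1 : ∀ r ∈ Icc 0 s, ‖h1 r - h1 0 - r • h2 0‖ ≤ ε * s := fun r hr => by
    have := (convex_Icc 0 s).norm_image_sub_le_of_norm_hasDerivWithin_le
      (fun x _ => (hg x).hasDerivWithinAt) hε (left_mem_Icc.2 hs) hr
    simp only [sub_self, zero_smul, sub_zero, Real.norm_of_nonneg hr.1] at this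
    exact this.trans (mul_le_mul_of_nonneg_left hr.2 hε0)
  have := (convex_Icc 0 s).norm_image_sub_le_of_norm_hasDerivWithin_le
      (fun x _ => (hf x).hasDerivWithinAt) b1 (left_mem_Icc.2 hs) (right_mem_Icc.2 hs)
  simp only [sub_self, zero_smul, sub_zero, Real.norm_of_nonneg hs, ne_eq, OfNat.ofNat_ne_zero,
    not_false_eq_true, zero_pow, zero_div] at this
  linarith [this, (by ring : ε * s * s = ε * s ^ 2)]

variable {Y : Type*} [NormedAddCommGroup Y] [NormedSpace ℝ Y]

/-- The integrand `K((0,q) + s(1,-σy), y) φ(q - sy)`. -/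
def shiftInt (K : ℝ × Y → Y → ℝ) (φ : Y → ℂ) (σ s : ℝ) (q y : Y) : ℂ :=
  K ((0, q) + s • (1, -(σ • y))) y • φ (q + s • (-y))

/-- The first `s`-derivative of `shiftInt`. -/
def shiftInt₁ (K : ℝ × Y → Y → ℝ) (φ : Y → ℂ) (σ s : ℝ) (q y : Y) : ℂ :=
  K ((0, q) + s • (1, -(σ • y))) y • fderiv ℝ φ (q + s • (-y)) (-y) +
  fderiv ℝ (fun x => K x y) ((0, q) + s • (1, -(σ • y))) (1, -(σ • y)) • φ (q + s • (-y))

/-- The second `s`-derivative of `shiftInt`. -/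
def shiftInt₂ (K : ℝ × Y → Y → ℝ) (φ : Y → ℂ) (σ s : ℝ) (q y : Y) : ℂ :=
  K ((0, q) + s • (1, -(σ • y))) y • fderiv ℝ (fderiv ℝ φ) (q + s • (-y)) (-y) (-y) +
  (2 * fderiv ℝ (fun x => K x y) ((0, q) + s • (1, -(σ • y))) (1, -(σ • y))) •
    fderiv ℝ φ (q + s • (-y)) (-y) +
  fderiv ℝ (fderiv ℝ (fun x => K x y)) ((0, q) + s • (1, -(σ • y))) (1, -(σ • y))
    (1, -(σ • y)) • φ (q + s • (-y))

variable {K : ℝ × Y → Y → ℝ} {φ : Y → ℂ} {σ : ℝ}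

theorem hasDerivAt_shiftInt (hK : ContDiff ℝ 2 (Function.uncurry K)) (hφ : ContDiff ℝ 2 φ)
    (q y : Y) (s : ℝ) :
    HasDerivAt (fun s => shiftInt K φ σ s q y) (shiftInt₁ K φ σ s q y) s := by
  have h1 := hasDerivAt_comp_line (p := ((0 : ℝ), q)) (v := ((1 : ℝ), -(σ • y))) (s := s)
    (((ContDiff.slice_left hK y).differentiable (by norm_num)) _)
  have h2 := hasDerivAt_comp_line (p := q) (v := -y) (s := s) ((hφ.differentiable (by norm_num)) _)
  exact h1.smul h2

theorem hasDerivAt_shiftInt₁ (hK : ContDiff ℝ 2 (Function.uncurry K)) (hφ : ContDiff ℝ 2 φ)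
    (q y : Y) (s : ℝ) :
    HasDerivAt (fun s => shiftInt₁ K φ σ s q y) (shiftInt₂ K φ σ s q y) s := by
  have hs := ContDiff.slice_left hK y
  have h1 := hasDerivAt_comp_line (p := ((0 : ℝ), q)) (v := ((1 : ℝ), -(σ • y))) (s := s)
    ((hs.differentiable (by norm_num)) _)
  have h2 := hasDerivAt_comp_line (p := q) (v := -y) (s := s) ((hφ.differentiable (by norm_num)) _)
  have h3 := hasDerivAt_fderiv_comp_line hs ((0 : ℝ), q) ((1 : ℝ), -(σ • y))
    ((1 : ℝ), -(σ • y)) s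
  have h4 := hasDerivAt_fderiv_comp_line hφ q (-y) (-y) s
  refine ((h1.smul h4).add (h3.smul h2)).congr_deriv ?_
  simp only [shiftInt₂, two_mul, add_smul]
  abel

theorem continuous_shiftInt (hK : ContDiff ℝ 2 (Function.uncurry K)) (hφ : ContDiff ℝ 2 φ) :
    Continuous (fun p : ℝ × Y × Y => shiftInt K φ σ p.1 p.2.1 p.2.2) ∧
    Continuous (fun p : ℝ × Y × Y => shiftInt₁ K φ σ p.1 p.2.1 p.2.2) ∧
    Continuous (fun p : ℝ × Y × Y => shiftInt₂ K φ σ p.1 p.2.1 p.2.2) := by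
  have e1 : Continuous fun p : ℝ × Y × Y =>
      ((((0 : ℝ), p.2.1) + p.1 • ((1 : ℝ), -(σ • p.2.2))), p.2.2) := by fun_prop
  have k0 := hK.continuous.comp e1
  have k1 := (contDiff_fderiv_slice hK).continuous.comp e1
  have k2 := (continuous_fderiv_fderiv_slice hK).comp e1
  have e2 : Continuous fun p : ℝ × Y × Y => p.2.1 + p.1 • (-p.2.2) := by fun_prop
  have p0 := hφ.continuous.comp e2
  have p1 := (hφ.continuous_fderiv (by norm_num)).comp e2
  have p2 := ((hφ.fderiv_right (m := 1) (by norm_num)).continuous_fderiv (by norm_num)).comp e2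
  have ev : Continuous fun p : ℝ × Y × Y => ((1 : ℝ), -(σ • p.2.2)) := by fun_prop
  have ey : Continuous fun p : ℝ × Y × Y => -p.2.2 := by fun_prop
  refine ⟨k0.smul p0, (k0.smul (p1.clm_apply ey)).add ((k1.clm_apply ev).smul p0),
    ((k0.smul ((p2.clm_apply ey).clm_apply ey)).add
      ((continuous_const.mul (k1.clm_apply ev)).smul (p1.clm_apply ey))).add
      (((k2.clm_apply ev).clm_apply ev).smul p0)⟩

omit [NormedSpace ℝ Y] in
theorem exists_norm_le_one_add_pow_inv {W : Type*} [NormedAddCommGroup W] {f : Y → W}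
    (hf : Continuous f) (hc : HasCompactSupport f) (N : ℕ) :
    ∃ B : ℝ, 0 ≤ B ∧ ∀ z, ‖f z‖ ≤ B * ((1 + ‖z‖) ^ N)⁻¹ := by
  have h1 : Continuous fun z => (1 + ‖z‖) ^ N * ‖f z‖ := by fun_prop
  obtain ⟨B, hB⟩ := (hc.norm.mul_left (f := fun z => (1 + ‖z‖) ^ N)).exists_bound_of_continuous h1
  refine ⟨B, (norm_nonneg _).trans (hB 0), fun z => ?_⟩
  have h2 := (le_abs_self _).trans (hB z)
  rw [← div_eq_mul_inv, le_div_iff₀ (by positivity), mul_comm]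
  exact h2

theorem norm_shiftInt₂_le (hK : GaussBdd {x : ℝ × Y | |x.1| ≤ 1} K) (hφ : ContDiff ℝ 2 φ)
    (hc : HasCompactSupport φ) (hσ : |σ| ≤ 1) (N : ℕ) :
    ∃ C a : ℝ, 0 < a ∧ ∀ s, |s| ≤ 1 → ∀ q y : Y,
      ‖shiftInt K φ σ s q y‖ ≤ C * (((1 + ‖q‖) ^ N)⁻¹ * Real.exp (-(a * ‖y‖ ^ 2))) ∧
      ‖shiftInt₁ K φ σ s q y‖ ≤ C * (((1 + ‖q‖) ^ N)⁻¹ * Real.exp (-(a * ‖y‖ ^ 2))) ∧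
      ‖shiftInt₂ K φ σ s q y‖ ≤ C * (((1 + ‖q‖) ^ N)⁻¹ * Real.exp (-(a * ‖y‖ ^ 2))) := by
  obtain ⟨C, a, hC, ha, h⟩ := hK.norm_le
  obtain ⟨D, hD, hD'⟩ := exists_one_add_pow_le_exp (N + 2) (half_pos ha)
  obtain ⟨B0, hB0, hB0'⟩ := exists_norm_le_one_add_pow_inv hφ.continuous hc N
  obtain ⟨B1, hB1, hB1'⟩ := exists_norm_le_one_add_pow_inv
    (hφ.continuous_fderiv (by norm_num)) (hc.fderiv (𝕜 := ℝ)) N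
  obtain ⟨B2, hB2, hB2'⟩ := exists_norm_le_one_add_pow_inv
    ((hφ.fderiv_right (m := 1) (by norm_num)).continuous_fderiv (by norm_num))
    ((hc.fderiv (𝕜 := ℝ)).fderiv (𝕜 := ℝ)) N
  refine ⟨C * D * (B2 + 2 * B1 + B0), a / 2, half_pos ha, fun s hs q y => ?_⟩
  set x : ℝ × Y := (0, q) + s • (1, -(σ • y)) with hx
  obtain ⟨k0, k1, k2⟩ := h x (by simpa [hx] using hs) y
  set z := q + s • (-y) with hz
  set v : ℝ × Y := (1, -(σ • y)) with hv
  set E := C * Real.exp (-(a * ‖y‖ ^ 2)) with hE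
  have hE0 : 0 < E := by positivity
  set Q := ((1 + ‖z‖) ^ N)⁻¹ with hQ
  have hQ0 : 0 < Q := by positivity
  set R := 1 + ‖y‖ with hR
  have hR1 : 1 ≤ R := by linarith [norm_nonneg y]
  have hyR : ‖-y‖ ≤ R := by rw [norm_neg]; linarith
  have hvR : ‖v‖ ≤ R := by
    rw [hv, Prod.norm_def, norm_neg, norm_smul, norm_one]
    refine max_le hR1 ((mul_le_of_le_one_left (norm_nonneg y) hσ).trans (by linarith))
  have hQq : Q ≤ R ^ N * ((1 + ‖q‖) ^ N)⁻¹ := by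
    rw [hQ, ← div_eq_mul_inv, inv_le_comm₀ (by positivity) (by positivity), inv_div, div_le_iff₀
      (by positivity), ← mul_pow]
    refine pow_le_pow_left₀ (by positivity) ?_ N
    have : ‖q‖ ≤ ‖z‖ + ‖y‖ := by
      have e : q = z + s • y := by simp [hz]
      rw [e]
      refine (norm_add_le _ _).trans ?_
      simp only [norm_smul]
      gcongr
      exact mul_le_of_le_one_left (norm_nonneg y) hs
    nlinarith [norm_nonneg z, norm_nonneg y]
  have p0 := hB0' z
  have p1 : ‖fderiv ℝ φ z (-y)‖ ≤ B1 * Q * R := (ContinuousLinearMap.le_opNorm _ _).trans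
    (mul_le_mul (hB1' z) hyR (norm_nonneg _) (by positivity))
  have p2 : ‖fderiv ℝ (fderiv ℝ φ) z (-y) (-y)‖ ≤ B2 * Q * R * R :=
    (ContinuousLinearMap.le_opNorm₂ _ _ _).trans (by gcongr; exact hB2' z)
  have l1 : ‖fderiv ℝ (fun x => K x y) x v‖ ≤ E * R := (ContinuousLinearMap.le_opNorm _ _).trans
    (by gcongr)
  have l2 : ‖fderiv ℝ (fderiv ℝ (fun x => K x y)) x v v‖ ≤ E * R * R :=
    (ContinuousLinearMap.le_opNorm₂ _ _ _).trans (by gcongr)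
  have hRR : R ≤ R * R := le_mul_of_one_le_left (by positivity) hR1
  have hR1' : 1 ≤ R * R := hR1.trans hRR
  have main : E * Q * (R * R) ≤ C * D * (((1 + ‖q‖) ^ N)⁻¹ * Real.exp (-(a / 2 * ‖y‖ ^ 2))) := by
    calc E * Q * (R * R) ≤ E * (R ^ N * ((1 + ‖q‖) ^ N)⁻¹) * (R * R) := by gcongr
      _ = E * R ^ (N + 2) * ((1 + ‖q‖) ^ N)⁻¹ := by ring
      _ ≤ E * (D * Real.exp (a / 2 * ‖y‖ ^ 2)) * ((1 + ‖q‖) ^ N)⁻¹ := by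
        gcongr
        exact hD' _ (norm_nonneg y)
      _ = C * D * (((1 + ‖q‖) ^ N)⁻¹ *
          (Real.exp (-(a * ‖y‖ ^ 2)) * Real.exp (a / 2 * ‖y‖ ^ 2))) := by rw [hE]; ring
      _ = _ := by rw [← Real.exp_add]; ring_nf
  have fin : ∀ w : ℂ, ‖w‖ ≤ (B2 + 2 * B1 + B0) * (E * Q * (R * R)) →
      ‖w‖ ≤ C * D * (B2 + 2 * B1 + B0) *
        (((1 + ‖q‖) ^ N)⁻¹ * Real.exp (-(a / 2 * ‖y‖ ^ 2))) := fun w hw =>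
    hw.trans ((mul_le_mul_of_nonneg_left main (by positivity)).trans (le_of_eq (by ring)))
  have hEQ : 0 < E * Q := by positivity
  have t2 : ‖K x y • fderiv ℝ (fderiv ℝ φ) z (-y) (-y)‖ ≤ B2 * (E * Q * (R * R)) := by
    rw [norm_smul]
    exact (mul_le_mul k0 p2 (norm_nonneg _) hE0.le).trans (le_of_eq (by ring))
  have t1 : ‖K x y • fderiv ℝ φ z (-y)‖ ≤ B1 * (E * Q * R) := by
    rw [norm_smul]
    exact (mul_le_mul k0 p1 (norm_nonneg _) hE0.le).trans (le_of_eq (by ring))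
  have t0 : ‖K x y • φ z‖ ≤ B0 * (E * Q * 1) := by
    rw [norm_smul]
    exact (mul_le_mul k0 p0 (norm_nonneg _) hE0.le).trans (le_of_eq (by ring))
  have s1 : ‖(2 * fderiv ℝ (fun x => K x y) x v) • fderiv ℝ φ z (-y)‖ ≤
      2 * B1 * (E * Q * (R * R)) := by
    rw [norm_smul, norm_mul, Real.norm_of_nonneg zero_le_two, mul_assoc, mul_assoc]
    refine mul_le_mul_of_nonneg_left ?_ zero_le_two
    exact (mul_le_mul l1 p1 (norm_nonneg _) (by positivity)).trans (le_of_eq (by ring))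
  have s0 : ‖fderiv ℝ (fun x => K x y) x v • φ z‖ ≤ B0 * (E * Q * R) := by
    rw [norm_smul]
    exact (mul_le_mul l1 p0 (norm_nonneg _) (by positivity)).trans (le_of_eq (by ring))
  have r0 : ‖fderiv ℝ (fderiv ℝ (fun x => K x y)) x v v • φ z‖ ≤ B0 * (E * Q * (R * R)) := by
    rw [norm_smul]
    exact (mul_le_mul l2 p0 (norm_nonneg _) (by positivity)).trans (le_of_eq (by ring))
  have u1 : E * Q * R ≤ E * Q * (R * R) := mul_le_mul_of_nonneg_left hRR hEQ.le
  have u0 : E * Q * 1 ≤ E * Q * (R * R) := mul_le_mul_of_nonneg_left hR1' hEQ.le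
  have hT : 0 ≤ E * Q * (R * R) := by positivity
  refine ⟨fin _ ?_, fin _ ?_, fin _ ?_⟩
  · refine t0.trans ((mul_le_mul_of_nonneg_left u0 hB0).trans ?_)
    exact mul_le_mul_of_nonneg_right (by linarith) hT
  · refine (norm_add_le _ _).trans ((add_le_add (t1.trans (mul_le_mul_of_nonneg_left u1 hB1))
      (s0.trans (mul_le_mul_of_nonneg_left u1 hB0))).trans ?_)
    rw [← add_mul]
    exact mul_le_mul_of_nonneg_right (by linarith) hT
  · refine (norm_add_le _ _).trans ((add_le_add ((norm_add_le _ _).trans (add_le_add t2 s1))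
      r0).trans ?_)
    rw [← add_mul, ← add_mul]

end Taylor

section TaylorIntegral

variable {Y : Type*} [NormedAddCommGroup Y] [NormedSpace ℝ Y] [FiniteDimensional ℝ Y]
  [MeasurableSpace Y] [BorelSpace Y] {μ : Measure Y} [μ.IsAddHaarMeasure]
  {K : ℝ × Y → Y → ℝ} {φ : Y → ℂ} {σ : ℝ}

theorem tendsto_integral_norm_shiftInt (hK : GaussBdd {x : ℝ × Y | |x.1| ≤ 1} K)
    (hφ : ContDiff ℝ 2 φ) (hc : HasCompactSupport φ) (hσ : |σ| ≤ 1) {ℓ : Y → ℂ}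
    (h0 : ∀ q, ∫ y, shiftInt K φ σ 0 q y ∂μ = φ q)
    (h1 : ∀ q, ∫ y, shiftInt₁ K φ σ 0 q y ∂μ = 0)
    (h2 : ∀ q, ∫ y, shiftInt₂ K φ σ 0 q y ∂μ = 2 * ℓ q) :
    Tendsto (fun s : ℝ => ∫ q, ‖(s ^ 2)⁻¹ • ((∫ y, shiftInt K φ σ s q y ∂μ) - φ q) - ℓ q‖ ∂μ)
      (𝓝[>] 0) (𝓝 0) := by
  have : SecondCountableTopology Y := secondCountable_of_proper
  obtain ⟨C, a, ha, hb⟩ := norm_shiftInt₂_le hK hφ hc hσ (Module.finrank ℝ Y + 1)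
  obtain ⟨c0, c1, c2⟩ := continuous_shiftInt (σ := σ) hK.1 hφ
  set G : Y × Y → ℝ := fun p => C * (((1 + ‖p.1‖) ^ (Module.finrank ℝ Y + 1))⁻¹ *
    Real.exp (-(a * ‖p.2‖ ^ 2))) with hG
  have hGint : Integrable G (μ.prod μ) :=
    ((integrable_one_add_pow_inv μ).mul_prod (integrable_exp_neg_mul_sq_norm μ ha)).const_mul C
  set R : ℝ → Y × Y → ℂ := fun s p => (s ^ 2)⁻¹ • (shiftInt K φ σ s p.1 p.2 -
    shiftInt K φ σ 0 p.1 p.2 - s • shiftInt₁ K φ σ 0 p.1 p.2 -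
    (s ^ 2 / 2) • shiftInt₂ K φ σ 0 p.1 p.2) with hR
  have hRc : ∀ s, Continuous (R s) := fun s => by
    have e : ∀ r : ℝ, Continuous fun p : Y × Y => (r, p.1, p.2) := fun r => by fun_prop
    have a0 := c0.comp (e s)
    have b0 := c0.comp (e 0)
    have b1 := c1.comp (e 0)
    have b2 := c2.comp (e 0)
    exact (((a0.sub b0).sub (b1.const_smul s)).sub (b2.const_smul (s ^ 2 / 2))).const_smul
      (s ^ 2)⁻¹
  have hRε : ∀ s ∈ Ioc (0 : ℝ) 1, ∀ p : Y × Y, ∀ ε : ℝ, (∀ r ∈ Icc 0 s,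
      ‖shiftInt₂ K φ σ r p.1 p.2 - shiftInt₂ K φ σ 0 p.1 p.2‖ ≤ ε) → ‖R s p‖ ≤ ε := by
    intro s hs p ε hε
    have := norm_taylor_two_le (hasDerivAt_shiftInt (σ := σ) hK.1 hφ p.1 p.2)
      (hasDerivAt_shiftInt₁ hK.1 hφ p.1 p.2) hs.1.le hε
    have hs2 : 0 < s ^ 2 := pow_pos hs.1 2
    rw [hR, norm_smul, norm_inv, Real.norm_of_nonneg hs2.le, inv_mul_le_iff₀ hs2, mul_comm]
    exact this
  have hRG : ∀ s ∈ Ioc (0 : ℝ) 1, ∀ p, ‖R s p‖ ≤ 2 * G p := fun s hs p =>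
    hRε s hs p _ fun r hr => by
      refine (norm_sub_le _ _).trans ?_
      have h3 := (hb r (by rw [abs_of_nonneg hr.1]; exact hr.2.trans hs.2) p.1 p.2).2.2
      have h4 := (hb 0 (by simp) p.1 p.2).2.2
      linarith
  have hev : ∀ᶠ s : ℝ in 𝓝[>] 0, s ∈ Ioc (0 : ℝ) 1 := Ioc_mem_nhdsGT one_pos
  have hlim : Tendsto (fun s => ∫ p, ‖R s p‖ ∂(μ.prod μ)) (𝓝[>] 0) (𝓝 0) := by
    have := tendsto_integral_filter_of_dominated_convergence (μ := μ.prod μ) (l := 𝓝[>] (0 : ℝ))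
      (F := fun s p => ‖R s p‖) (f := fun _ => (0 : ℝ)) (fun p => 2 * G p)
      (Eventually.of_forall fun s => (hRc s).norm.aestronglyMeasurable)
      (hev.mono fun s hs => Eventually.of_forall fun p => by simpa using hRG s hs p)
      (hGint.const_mul 2) ?_
    · simpa using this
    · refine Eventually.of_forall fun p => ?_
      rw [Metric.tendsto_nhds]
      intro ε hε
      have hcont : Continuous fun s => shiftInt₂ K φ σ s p.1 p.2 :=
        c2.comp (by fun_prop : Continuous fun s : ℝ => (s, p.1, p.2))
      obtain ⟨δ, hδ, hδ'⟩ := Metric.continuous_iff.1 hcont 0 (ε / 2) (half_pos hε)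
      filter_upwards [hev, Ioo_mem_nhdsGT hδ] with s hs hsδ
      have : ‖R s p‖ ≤ ε / 2 := hRε s hs p _ fun r hr => by
        have := hδ' r (by rw [Real.dist_eq, sub_zero, abs_of_nonneg hr.1]; exact hr.2.trans_lt hsδ.2)
        rw [dist_eq_norm] at this
        exact this.le
      rw [Real.dist_eq, sub_zero, abs_of_nonneg (norm_nonneg _)]
      linarith
  refine squeeze_zero' (Eventually.of_forall fun s => integral_nonneg fun q => norm_nonneg _)
    (hev.mono fun s hs => ?_) hlim
  have hRint : Integrable (R s) (μ.prod μ) :=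
    (hGint.const_mul 2).mono' (hRc s).aestronglyMeasurable (Eventually.of_forall (hRG s hs))
  rw [integral_prod _ hRint.norm]
  refine integral_mono_of_nonneg (Eventually.of_forall fun q => norm_nonneg _)
    hRint.norm.integral_prod_left (Eventually.of_forall fun q => ?_)
  have hint : ∀ {f : ℝ × Y × Y → ℂ} (_ : Continuous f) (r : ℝ) (_ : ∀ y, ‖f (r, q, y)‖ ≤
      C * (((1 + ‖q‖) ^ (Module.finrank ℝ Y + 1))⁻¹ * Real.exp (-(a * ‖y‖ ^ 2)))),
      Integrable (fun y => f (r, q, y)) μ := fun hf r h =>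
    integrable_of_le_gauss (C := C * ((1 + ‖q‖) ^ (Module.finrank ℝ Y + 1))⁻¹)
      (hf.comp (by fun_prop)) ha fun y => (h y).trans (le_of_eq (by ring))
  have i0 : Integrable (fun y => shiftInt K φ σ s q y) μ :=
    hint c0 s fun y => (hb s (by rw [abs_of_nonneg hs.1.le]; exact hs.2) q y).1
  have j0 : Integrable (fun y => shiftInt K φ σ 0 q y) μ :=
    hint c0 0 fun y => (hb 0 (by simp) q y).1
  have j1 : Integrable (fun y => s • shiftInt₁ K φ σ 0 q y) μ :=
    (hint c1 0 fun y => (hb 0 (by simp) q y).2.1).smul s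
  have j2 : Integrable (fun y => (s ^ 2 / 2) • shiftInt₂ K φ σ 0 q y) μ :=
    (hint c2 0 fun y => (hb 0 (by simp) q y).2.2).smul (s ^ 2 / 2)
  have hRq : ∫ y, R s (q, y) ∂μ =
      (s ^ 2)⁻¹ • ((∫ y, shiftInt K φ σ s q y ∂μ) - φ q) - ℓ q := by
    have hs2 : (s : ℂ) ≠ 0 := by exact_mod_cast hs.1.ne'
    simp only [hR]
    have e0 : Integrable (fun y => shiftInt K φ σ s q y - shiftInt K φ σ 0 q y) μ := i0.sub j0
    have e1 : Integrable (fun y => shiftInt K φ σ s q y - shiftInt K φ σ 0 q y -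
      s • shiftInt₁ K φ σ 0 q y) μ := e0.sub j1
    rw [integral_smul, integral_sub e1 j2, integral_sub e0 j1, integral_sub i0 j0, integral_smul, integral_smul, h0,
      h1, h2, smul_zero, sub_zero, smul_sub, smul_smul]
    congr 1
    rw [Complex.real_smul]
    push_cast
    field_simp
  simp only
  rw [← hRq]
  exact norm_integral_le_integral_norm _

end TaylorIntegral

section GaussianMatrix

open scoped Matrix

variable {d : ℕ} {M : Matrix (Fin d) (Fin d) ℝ}

theorem quadF_eq_dotProduct (M : Matrix (Fin d) (Fin d) ℝ) (v : Ed d) :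
    quadF M v = v.ofLp ⬝ᵥ (M *ᵥ v.ofLp) := by
  simp only [quadF, dotProduct, Matrix.mulVec, Finset.mul_sum, mul_assoc]

theorem norm_sq_eq_dotProduct (v : Ed d) : ‖v‖ ^ 2 = v.ofLp ⬝ᵥ v.ofLp := by
  rw [EuclideanSpace.real_norm_sq_eq]
  simp only [dotProduct, sq]

theorem quadF_neg (M : Matrix (Fin d) (Fin d) ℝ) (v : Ed d) : quadF M (-v) = quadF M v := by
  simp [quadF]

theorem quadF_smul (M : Matrix (Fin d) (Fin d) ℝ) (r : ℝ) (v : Ed d) :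
    quadF M (r • v) = r ^ 2 * quadF M v := by
  simp only [quadF, Finset.mul_sum, PiLp.smul_apply, smul_eq_mul]
  exact Finset.sum_congr rfl fun i _ => Finset.sum_congr rfl fun j _ => by ring

theorem posDef_of_quadF_le (hM : M.IsSymm) {a₀ : ℝ} (ha₀ : 0 < a₀)
    (h : ∀ p : Ed d, a₀ * ‖p‖ ^ 2 ≤ quadF M p) : M.PosDef := by
  refine Matrix.PosDef.of_dotProduct_mulVec_pos (by
    rw [Matrix.IsHermitian, Matrix.conjTranspose_eq_transpose_of_trivial]; exact hM)
    fun x hx => ?_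
  have h1 := h (WithLp.toLp 2 x)
  rw [quadF_eq_dotProduct] at h1
  have h2 : 0 < ‖(WithLp.toLp 2 x : Ed d)‖ := norm_pos_iff.2 (by simpa using hx)
  simp only [star_trivial]
  exact lt_of_lt_of_le (by positivity) h1

theorem pow_le_det_of_quadF_le (hM : M.IsSymm) {a₀ : ℝ} (ha₀ : 0 < a₀)
    (h : ∀ p : Ed d, a₀ * ‖p‖ ^ 2 ≤ quadF M p) : a₀ ^ d ≤ M.det := by
  have hH : M.IsHermitian := by
    rw [Matrix.IsHermitian, Matrix.conjTranspose_eq_transpose_of_trivial]; exact hM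
  have h1 : ∀ i, a₀ ≤ hH.eigenvalues i := fun i => by
    have h2 := h (hH.eigenvectorBasis i)
    rw [hH.eigenvectorBasis.orthonormal.1 i, one_pow, mul_one, quadF_eq_dotProduct] at h2
    simpa [hH.eigenvalues_eq] using h2
  have h3 := hH.det_eq_prod_eigenvalues
  simp only [RCLike.ofReal_real_eq_id, id_eq] at h3
  rw [h3]
  calc a₀ ^ d = ∏ _i : Fin d, a₀ := by simp
    _ ≤ _ := Finset.prod_le_prod (fun _ _ => ha₀.le) fun i _ => h1 i

theorem norm_sq_div_le_quadF_inv (hM : M.IsSymm) (hdet : IsUnit M.det) {A₀ : ℝ} (hA₀ : 0 < A₀)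
    (h0 : ∀ p : Ed d, 0 ≤ quadF M p) (h : ∀ p : Ed d, quadF M p ≤ A₀ * ‖p‖ ^ 2) (v : Ed d) :
    ‖v‖ ^ 2 / A₀ ≤ quadF M⁻¹ v := by
  set w := M⁻¹ *ᵥ v.ofLp with hw
  have h1 : M *ᵥ w = v.ofLp := by rw [hw, Matrix.mulVec_mulVec, M.mul_nonsing_inv hdet,
    Matrix.one_mulVec]
  have h2 := h0 (WithLp.toLp 2 (w - A₀⁻¹ • v.ofLp))
  rw [quadF_eq_dotProduct] at h2
  simp only [Matrix.mulVec_sub, Matrix.mulVec_smul, h1] at h2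
  have h3 := h v
  rw [quadF_eq_dotProduct, norm_sq_eq_dotProduct] at h3
  rw [quadF_eq_dotProduct, norm_sq_eq_dotProduct, ← hw]
  have h4 : w ⬝ᵥ (M *ᵥ v.ofLp) = v.ofLp ⬝ᵥ v.ofLp := by
    rw [Matrix.dotProduct_mulVec, ← Matrix.mulVec_transpose, hM, h1]
  simp only [sub_dotProduct, dotProduct_sub, smul_dotProduct, dotProduct_smul, smul_eq_mul, h4,
    dotProduct_comm w v.ofLp] at h2
  have h5 : A₀⁻¹ * (A₀⁻¹ * (v.ofLp ⬝ᵥ M *ᵥ v.ofLp)) ≤ A₀⁻¹ * (v.ofLp ⬝ᵥ v.ofLp) := by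
    refine mul_le_mul_of_nonneg_left ?_ (by positivity)
    rw [inv_mul_le_iff₀ hA₀]
    exact h3
  rw [div_eq_inv_mul]
  linarith

/-- The density `(4π)^{-d/2} (det M)^{-1/2} exp(-y·M⁻¹y/4)`. -/
def gdens (M : Matrix (Fin d) (Fin d) ℝ) (y : Ed d) : ℝ :=
  (4 * Real.pi) ^ (-(d : ℝ) / 2) * M.det ^ (-(1 : ℝ) / 2) * Real.exp (-(quadF M⁻¹ y) / 4)

theorem continuous_quadF (M : Matrix (Fin d) (Fin d) ℝ) : Continuous (quadF M) := by
  unfold quadF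
  fun_prop

theorem continuous_gdens (M : Matrix (Fin d) (Fin d) ℝ) : Continuous (gdens M) := by
  have := continuous_quadF M⁻¹
  unfold gdens
  fun_prop

open scoped MatrixOrder in
theorem exists_eq_transpose_mul_self (hM : M.PosDef) :
    ∃ B : Matrix (Fin d) (Fin d) ℝ, M = Bᵀ * B := by
  obtain ⟨B, hB⟩ := CStarAlgebra.nonneg_iff_eq_star_mul_self.mp hM.posSemidef.nonneg
  exact ⟨B, by rw [hB, Matrix.star_eq_conjTranspose,
    Matrix.conjTranspose_eq_transpose_of_trivial]⟩

theorem integral_gdens (hM : M.PosDef) : ∫ y, gdens M y = 1 := by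
  obtain ⟨B, hB⟩ := exists_eq_transpose_mul_self hM.inv
  have hMdet := hM.det_pos
  have hdet : M.det⁻¹ = B.det ^ 2 := by
    rw [← Ring.inverse_eq_inv', ← Matrix.det_nonsing_inv, hB, Matrix.det_mul,
      Matrix.det_transpose, sq]
  have hB0 : B.det ≠ 0 := fun h => by
    rw [h] at hdet
    simp [hMdet.ne'] at hdet
  set L := Matrix.toLpLin 2 2 B with hL
  have hLdet : LinearMap.det L = B.det := LinearMap.det_toLpLin 2 B
  have h1 : ∀ y : Ed d, quadF M⁻¹ y = ‖L y‖ ^ 2 := fun y => by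
    rw [quadF_eq_dotProduct, hB, norm_sq_eq_dotProduct, ← Matrix.mulVec_mulVec,
      Matrix.dotProduct_mulVec, Matrix.vecMul_transpose]
    rfl
  have h2 : ∫ y : Ed d, Real.exp (-(1 / 4) * ‖L y‖ ^ 2) =
      |B.det|⁻¹ * (4 * Real.pi) ^ ((d : ℝ) / 2) := by
    have h3 := Measure.map_linearMap_addHaar_eq_smul_addHaar (volume : Measure (Ed d))
      (f := L) (by rwa [hLdet])
    have hLc : Continuous L := L.continuous_of_finiteDimensional
    rw [← integral_map (φ := L) hLc.aemeasurable
      (f := fun z : Ed d => Real.exp (-(1 / 4) * ‖z‖ ^ 2))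
      (by fun_prop : Continuous fun z : Ed d => Real.exp (-(1 / 4) * ‖z‖ ^ 2)).aestronglyMeasurable,
      h3, integral_smul_measure, GaussianFourier.integral_rexp_neg_mul_sq_norm (by norm_num), hLdet]
    simp only [finrank_euclideanSpace, Fintype.card_fin, smul_eq_mul, abs_inv]
    rw [ENNReal.toReal_ofReal (by positivity)]
    congr 2
    ring
  have h4 : |B.det|⁻¹ = M.det ^ ((1 : ℝ) / 2) := by
    rw [← Real.sqrt_eq_rpow, ← Real.sqrt_sq_eq_abs, ← hdet, Real.sqrt_inv, inv_inv]
  simp only [gdens]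
  rw [integral_const_mul]
  have h5 : ∀ y : Ed d, -(quadF M⁻¹ y) / 4 = -(1 / 4) * ‖L y‖ ^ 2 := fun y => by rw [h1]; ring
  simp only [h5]
  rw [h2, h4, show -(d : ℝ) / 2 = -((d : ℝ) / 2) by ring, show -(1 : ℝ) / 2 = -(1 / 2) by ring,
    Real.rpow_neg (by positivity), Real.rpow_neg hMdet.le]
  have := Real.rpow_pos_of_pos hMdet (1 / 2)
  have : 0 < (4 * Real.pi) ^ ((d : ℝ) / 2) := Real.rpow_pos_of_pos (by positivity) _
  field_simp

theorem integral_coord_mul_gdens (M : Matrix (Fin d) (Fin d) ℝ) (i : Fin d) :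
    ∫ y : Ed d, y i * gdens M y = 0 := by
  have h := integral_neg_eq_self (fun y : Ed d => y i * gdens M y) volume
  have h1 : ∀ y : Ed d, (-y) i * gdens M (-y) = -(y i * gdens M y) := fun y => by
    simp [gdens, quadF_neg]
  simp only [h1] at h
  rw [integral_neg] at h
  linarith

theorem quadF_add_smul_eb (hM : M.IsSymm) (v : Ed d) (k : Fin d) (r : ℝ) :
    quadF M (v + r • eb k) = quadF M v + 2 * r * (M *ᵥ v.ofLp) k + r ^ 2 * M k k := by
  have h1 : v.ofLp ⬝ᵥ M.col k = (M *ᵥ v.ofLp) k := by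
    rw [dotProduct_comm, Matrix.mulVec]
    congr 1
    ext j
    exact hM.apply k j
  rw [quadF_eq_dotProduct, quadF_eq_dotProduct]
  simp only [eb, WithLp.ofLp_add, WithLp.ofLp_smul, PiLp.ofLp_single, Matrix.mulVec_add,
    Matrix.mulVec_smul, Matrix.mulVec_single_one, add_dotProduct, dotProduct_add, smul_dotProduct,
    dotProduct_smul, single_dotProduct, smul_eq_mul, h1, one_mul, Matrix.col_apply]
  ring

theorem contDiff_gdens (M : Matrix (Fin d) (Fin d) ℝ) : ContDiff ℝ 2 (gdens M) := by
  unfold gdens quadF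
  fun_prop

theorem fderiv_gdens_eb (hM : M.IsSymm) (y : Ed d) (k : Fin d) :
    fderiv ℝ (gdens M) y (eb k) = -((M⁻¹ *ᵥ y.ofLp) k / 2) * gdens M y := by
  have hN : (M⁻¹).IsSymm := by
    rw [Matrix.IsSymm, Matrix.transpose_nonsing_inv, hM]
  have h1 := hasDerivAt_comp_line (f := gdens M) (p := y) (v := eb k) (s := 0)
    (((contDiff_gdens M).differentiable (by norm_num)) _)
  have h2 : HasDerivAt (fun r : ℝ => gdens M (y + r • eb k))
      (-((M⁻¹ *ᵥ y.ofLp) k / 2) * gdens M y) 0 := by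
    simp only [gdens, quadF_add_smul_eb hN]
    have e : HasDerivAt (fun r : ℝ => -(quadF M⁻¹ y + 2 * r * (M⁻¹ *ᵥ y.ofLp) k +
        r ^ 2 * M⁻¹ k k) / 4) (-((M⁻¹ *ᵥ y.ofLp) k / 2)) 0 := by
      have e1 := ((((hasDerivAt_id (0 : ℝ)).const_mul 2).mul_const ((M⁻¹ *ᵥ y.ofLp) k)).const_add
        (quadF M⁻¹ y)).add (((hasDerivAt_id (0 : ℝ)).pow 2).mul_const (M⁻¹ k k))
      refine (e1.neg.div_const 4).congr_deriv ?_
      simp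
      ring
    refine (e.exp.const_mul _).congr_deriv ?_
    simp
    ring
  simpa using h1.unique h2

theorem integrable_mul_gdens {a : ℝ} (ha : 0 < a)
    (hM : ∀ y : Ed d, a * ‖y‖ ^ 2 ≤ quadF M⁻¹ y) {P : Ed d → ℝ} (hP : Continuous P) {B : ℝ} {m : ℕ}
    (hB : ∀ y, |P y| ≤ B * (1 + ‖y‖) ^ m) : Integrable (fun y => P y * gdens M y) := by
  have hB0 : 0 ≤ B := by simpa using (abs_nonneg _).trans (hB 0)
  obtain ⟨D, hD, hD'⟩ := exists_one_add_pow_le_exp m (a := a / 8) (by positivity)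
  set c := (4 * Real.pi) ^ (-(d : ℝ) / 2) * M.det ^ (-(1 : ℝ) / 2) with hc
  refine integrable_of_le_gauss (hP.mul (continuous_gdens M)) (C := B * D * |c|) (a := a / 8)
    (by positivity) fun y => ?_
  rw [gdens, ← hc, norm_mul, norm_mul, Real.norm_eq_abs, Real.norm_eq_abs,
    Real.norm_of_nonneg (Real.exp_pos _).le]
  calc _ ≤ (B * (D * Real.exp (a / 8 * ‖y‖ ^ 2))) * (|c| * Real.exp (-(a * ‖y‖ ^ 2) / 4)) := by
        gcongr
        · exact (hB y).trans (by gcongr; exact hD' _ (norm_nonneg y))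
        · exact hM y
    _ = B * D * |c| * (Real.exp (a / 8 * ‖y‖ ^ 2) * Real.exp (-(a * ‖y‖ ^ 2) / 4)) := by ring
    _ = _ := by rw [← Real.exp_add]; ring_nf

theorem abs_coord_le (y : Ed d) (i : Fin d) : |y i| ≤ 1 * (1 + ‖y‖) ^ 1 := by
  have := PiLp.norm_apply_le y i
  rw [Real.norm_eq_abs] at this
  linarith

theorem abs_coord_mul_coord_le (y : Ed d) (i j : Fin d) : |y i * y j| ≤ 1 * (1 + ‖y‖) ^ 2 := by
  rw [abs_mul, sq, one_mul]
  have h1 := abs_coord_le y i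
  have h2 := abs_coord_le y j
  rw [one_mul, pow_one] at h1 h2
  gcongr

theorem integral_coord_mul_coord_mul_gdens (hM : M.PosDef) (hMs : M.IsSymm) {a : ℝ} (ha : 0 < a)
    (ha' : ∀ y : Ed d, a * ‖y‖ ^ 2 ≤ quadF M⁻¹ y) (i j : Fin d) :
    ∫ y : Ed d, y i * y j * gdens M y = 2 * M i j := by
  have hint : ∀ l k : Fin d, Integrable (fun y : Ed d => y l * y k * gdens M y) := fun l k =>
    integrable_mul_gdens ha ha' (by fun_prop) fun y => abs_coord_mul_coord_le y l k
  have hint0 : Integrable (fun y : Ed d => gdens M y) := by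
    simpa using integrable_mul_gdens (P := fun _ => (1 : ℝ)) (B := 1) (m := 0) ha ha'
      continuous_const (by simp)
  have hint1 : ∀ l : Fin d, Integrable (fun y : Ed d => y l * gdens M y) := fun l =>
    integrable_mul_gdens ha ha' (by fun_prop) fun y => abs_coord_le y l
  have hfd : ∀ (y : Ed d) (l k : Fin d), fderiv ℝ (fun y : Ed d => y l) y (eb k) =
      (1 : Matrix (Fin d) (Fin d) ℝ) l k := fun y l k => by
    have : (fun y : Ed d => y l) = EuclideanSpace.proj (𝕜 := ℝ) l := rfl
    rw [this, ContinuousLinearMap.fderiv]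
    simp [eb, Matrix.one_apply]
  have e : ∀ (l k : Fin d) (y : Ed d), y l * fderiv ℝ (gdens M) y (eb k) =
      ∑ m, (-(M⁻¹ k m / 2)) * (y l * y m * gdens M y) := fun l k y => by
    rw [fderiv_gdens_eb hMs, Matrix.mulVec, dotProduct, Finset.sum_div, ← Finset.sum_neg_distrib,
      Finset.sum_mul, Finset.mul_sum]
    exact Finset.sum_congr rfl fun m _ => by ring
  have key : ∀ l k : Fin d, ∑ m, M⁻¹ k m * ∫ y : Ed d, y l * y m * gdens M y =
      2 * (1 : Matrix (Fin d) (Fin d) ℝ) l k := fun l k => by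
    have h1 := integral_mul_fderiv_eq_neg_fderiv_mul_of_integrable (μ := (volume : Measure (Ed d)))
      (f := fun y : Ed d => y l) (g := gdens M) (v := eb k) ?_ ?_ (hint1 l)
      (fun y _ => by fun_prop) (fun y _ => ((contDiff_gdens M).differentiable (by norm_num)) y)
    · simp only [e, hfd] at h1
      rw [integral_finsetSum _ fun m _ => (hint l m).const_mul _, integral_const_mul,
        integral_gdens hM] at h1
      simp only [integral_const_mul] at h1
      have h2 : ∑ m, -(M⁻¹ k m / 2) * ∫ y : Ed d, y l * y m * gdens M y =
          -(1 / 2) * ∑ m, M⁻¹ k m * ∫ y : Ed d, y l * y m * gdens M y := by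
        rw [Finset.mul_sum]
        exact Finset.sum_congr rfl fun m _ => by ring
      linarith
    · simp only [hfd]
      exact hint0.const_mul _
    · simp only [e]
      exact integrable_finsetSum _ fun m _ => (hint l m).const_mul _
  set S : Matrix (Fin d) (Fin d) ℝ := Matrix.of fun m l => ∫ y : Ed d, y l * y m * gdens M y
  have h3 : M⁻¹ * S = 2 • (1 : Matrix (Fin d) (Fin d) ℝ) := by
    ext k l
    have := key l k
    simp only [Matrix.mul_apply, S, Matrix.of_apply]
    rw [this]
    simp [Matrix.one_apply, eq_comm]
  have h4 : S = M * 2 := by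
    have h5 := congrArg (M * ·) h3
    simpa [← Matrix.mul_assoc, Matrix.mul_nonsing_inv _ hM.det_pos.ne'.isUnit] using h5
  have h5 := congrFun (congrFun h4 j) i
  rw [mul_two] at h5
  simp only [S, Matrix.of_apply, Matrix.add_apply, ← two_mul] at h5
  rw [h5, hMs.apply]

end GaussianMatrix

section Kernel

theorem PolyBdd.prod {X Y : Type*} [NormedAddCommGroup X] [NormedSpace ℝ X]
    [NormedAddCommGroup Y] [NormedSpace ℝ Y] {S : Set X} {ι : Type*} (s : Finset ι)
    {u : ι → X → Y → ℝ} (hu : ∀ i, PolyBdd S (u i)) : PolyBdd S (fun x y => ∏ i ∈ s, u i x y) := by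
  classical
  induction s using Finset.induction_on with
  | empty => simpa using PolyBdd.const S (1 : ℝ)
  | insert i s hi ih =>
    simp_rw [Finset.prod_insert hi]
    exact (hu i).mul ih

theorem PolyBdd.det {X Y : Type*} [NormedAddCommGroup X] [NormedSpace ℝ X]
    [NormedAddCommGroup Y] [NormedSpace ℝ Y] {S : Set X} {d : ℕ}
    {B : X → Matrix (Fin d) (Fin d) ℝ}
    (h : ∀ i j, PolyBdd S (fun x (_ : Y) => B x i j)) :
    PolyBdd S (fun x (_ : Y) => (B x).det) := by
  simp_rw [Matrix.det_apply']
  exact PolyBdd.sum _ fun σ => (PolyBdd.const S _).mul (PolyBdd.prod _ fun i => h _ _)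

/-- A function of the first variable alone with polynomial bounds has bounded derivatives. -/
theorem PolyBdd.exists_bound {X Y : Type*} [NormedAddCommGroup X] [NormedSpace ℝ X]
    [NormedAddCommGroup Y] [NormedSpace ℝ Y] {S : Set X} {p : X → ℝ}
    (h : PolyBdd S (fun x (_ : Y) => p x)) :
    ContDiff ℝ 2 p ∧ ∀ k ≤ 2, ∃ C, ∀ x ∈ S, ‖iteratedFDeriv ℝ k p x‖ ≤ C := by
  obtain ⟨hc, C, m, -, hC⟩ := h
  exact ⟨ContDiff.slice_left hc 0, fun k hk => ⟨C, fun x hx => by simpa using hC x hx 0 k hk⟩⟩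

variable {X Y : Type*} [NormedAddCommGroup X] [NormedSpace ℝ X] [NormedAddCommGroup Y]
  [NormedSpace ℝ Y]

theorem PolyBdd.of_snd {S : Set (ℝ × X)} {f : X → ℝ} (hf : ContDiff ℝ 2 f)
    (hb : ∀ n ≤ 2, ∃ C : ℝ, ∀ q, ‖iteratedFDeriv ℝ n f q‖ ≤ C) :
    PolyBdd S (fun x (_ : Y) => f x.2) := by
  refine PolyBdd.of_bdd (hf.comp contDiff_snd) fun k hk => ?_
  obtain ⟨C, hC⟩ := hb k hk
  refine ⟨C * ‖ContinuousLinearMap.snd ℝ ℝ X‖ ^ k, fun x _ => ?_⟩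
  have h1 := (ContinuousLinearMap.snd ℝ ℝ X).iteratedFDeriv_comp_right hf x (i := k)
    (by exact_mod_cast hk)
  have h2 : (f ∘ (ContinuousLinearMap.snd ℝ ℝ X)) = fun x : ℝ × X => f x.2 := rfl
  rw [h2] at h1
  rw [h1]
  refine (ContinuousMultilinearMap.norm_compContinuousLinearMap_le _ _).trans ?_
  simp only [Finset.prod_const, Finset.card_univ, Fintype.card_fin]
  gcongr
  exact hC _

theorem PolyBdd.fst : PolyBdd {x : ℝ × X | |x.1| ≤ 1} (fun x (_ : Y) => x.1) := by
  refine PolyBdd.of_bdd contDiff_fst fun k hk => ?_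
  have h1 : fderiv ℝ (fun x : ℝ × X => x.1) = fun _ => ContinuousLinearMap.fst ℝ ℝ X :=
    funext fun x => fderiv_fst
  interval_cases k
  · exact ⟨1, fun x hx => by simpa using hx⟩
  · exact ⟨‖ContinuousLinearMap.fst ℝ ℝ X‖, fun x _ => by rw [norm_iteratedFDeriv_one, h1]⟩
  · refine ⟨0, fun x _ => ?_⟩
    rw [← norm_iteratedFDeriv_fderiv, h1, norm_iteratedFDeriv_one]
    simp

variable {d : ℕ}

/-- The boundedness, smoothness and ellipticity conditions on the coefficients. -/
structure GoodCoeffs (A : Ed d → Matrix (Fin d) (Fin d) ℝ) (b : Ed d → Ed d) (c : Ed d → ℝ)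
    (a₀ A₀ : ℝ) : Prop where
  symm : ∀ q, (A q).IsSymm
  contDiffA : ∀ i j, ContDiff ℝ 2 (fun q => A q i j)
  bddA : ∀ i j, ∀ n ≤ 2, ∃ C : ℝ, ∀ q, ‖iteratedFDeriv ℝ n (fun q => A q i j) q‖ ≤ C
  contDiffb : ContDiff ℝ 2 b
  bddb : ∀ n ≤ 2, ∃ C : ℝ, ∀ q, ‖iteratedFDeriv ℝ n b q‖ ≤ C
  contDiffc : ContDiff ℝ 2 c
  bddc : ∀ n ≤ 2, ∃ C : ℝ, ∀ q, ‖iteratedFDeriv ℝ n c q‖ ≤ C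
  pos : 0 < a₀
  le : a₀ ≤ A₀
  ell : ∀ q p : Ed d, a₀ * ‖p‖ ^ 2 ≤ quadF (A q) p ∧ quadF (A q) p ≤ A₀ * ‖p‖ ^ 2

/-- The rescaled kernel `e^{-s²c(q)} G_{A(q)}(y - s b(q))`, `G_M = gdens M`. -/
def sker (A : Ed d → Matrix (Fin d) (Fin d) ℝ) (b : Ed d → Ed d) (c : Ed d → ℝ)
    (x : ℝ × Ed d) (y : Ed d) : ℝ :=
  Real.exp (-(x.1 ^ 2 * c x.2)) * gdens (A x.2) (y - x.1 • b x.2)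

namespace GoodCoeffs

variable {A : Ed d → Matrix (Fin d) (Fin d) ℝ} {b : Ed d → Ed d} {c : Ed d → ℝ} {a₀ A₀ : ℝ}

theorem posDef (h : GoodCoeffs A b c a₀ A₀) (q : Ed d) : (A q).PosDef :=
  posDef_of_quadF_le (h.symm q) h.pos fun p => (h.ell q p).1

theorem le_quadF_inv (h : GoodCoeffs A b c a₀ A₀) (q y : Ed d) :
    A₀⁻¹ * ‖y‖ ^ 2 ≤ quadF (A q)⁻¹ y := by
  have := norm_sq_div_le_quadF_inv (h.symm q) (h.posDef q).det_pos.ne'.isUnit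
    (h.pos.trans_le h.le) (fun p => le_trans (by have := h.pos; positivity) (h.ell q p).1)
    (fun p => (h.ell q p).2) y
  rwa [div_eq_inv_mul] at this

theorem polyBdd_A (h : GoodCoeffs A b c a₀ A₀) (S : Set (ℝ × Ed d)) (i j : Fin d) :
    PolyBdd S (fun x (_ : Ed d) => A x.2 i j) :=
  PolyBdd.of_snd (h.contDiffA i j) (h.bddA i j)

theorem polyBdd_comp_det (h : GoodCoeffs A b c a₀ A₀) (S : Set (ℝ × Ed d)) {g : ℝ → ℝ}
    (hg : ContDiffOn ℝ 2 g (Ioi 0)) : PolyBdd S (fun x (_ : Ed d) => g (A x.2).det) := by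
  obtain ⟨hc, hb⟩ := (PolyBdd.det (h.polyBdd_A S)).exists_bound
  obtain ⟨C, hC⟩ := hb 0 (by norm_num)
  refine PolyBdd.of_comp (p := fun x : ℝ × Ed d => (A x.2).det) isOpen_Ioi
    (isCompact_Icc (a := a₀ ^ d) (b := C)) (fun x hx => (pow_pos h.pos d).trans_le hx.1) hg hc hb
    (fun x => (h.posDef x.2).det_pos) fun x hx => ⟨?_, ?_⟩
  · exact pow_le_det_of_quadF_le (h.symm _) h.pos fun p => (h.ell _ p).1
  · have := hC x hx
    rw [norm_iteratedFDeriv_zero] at this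
    exact (le_abs_self _).trans this

theorem polyBdd_inv (h : GoodCoeffs A b c a₀ A₀) (S : Set (ℝ × Ed d)) (i j : Fin d) :
    PolyBdd S (fun x (_ : Ed d) => (A x.2)⁻¹ i j) := by
  have h1 := h.polyBdd_comp_det S (g := fun r => r⁻¹)
    (contDiffOn_id.inv fun x hx => (mem_Ioi.1 hx).ne')
  simp_rw [Matrix.inv_def, Matrix.smul_apply, Ring.inverse_eq_inv', smul_eq_mul,
    Matrix.adjugate_apply]
  refine h1.mul (PolyBdd.det fun k l => ?_)
  simp only [Matrix.updateRow_apply]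
  split_ifs
  · exact PolyBdd.const S _
  · exact h.polyBdd_A S k l

theorem polyBdd_b (h : GoodCoeffs A b c a₀ A₀) (S : Set (ℝ × Ed d)) (i : Fin d) :
    PolyBdd S (fun x (_ : Ed d) => b x.2 i) := by
  refine PolyBdd.of_snd (f := fun q => b q i) (by have := h.contDiffb; fun_prop) fun n hn => ?_
  obtain ⟨C, hC⟩ := h.bddb n hn
  let pr : Ed d →L[ℝ] ℝ := EuclideanSpace.proj i
  refine ⟨‖pr‖ * C, fun q => ?_⟩
  have h1 := pr.norm_iteratedFDeriv_comp_left (h.contDiffb.contDiffAt (x := q)) (by exact_mod_cast hn)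
  exact h1.trans (by gcongr; exact hC q)

theorem sker_eq_exp (h : GoodCoeffs A b c a₀ A₀) (x : ℝ × Ed d) (y : Ed d) :
    sker A b c x y = Real.exp ((-(d : ℝ) / 2) * Real.log (4 * Real.pi) +
      (-(1 : ℝ) / 2) * Real.log (A x.2).det + -1 * (x.1 * x.1 * c x.2) +
      (-(1 : ℝ) / 4) * quadF (A x.2)⁻¹ (y - x.1 • b x.2)) := by
  rw [sker, gdens, Real.rpow_def_of_pos (by positivity), Real.rpow_def_of_pos (h.posDef _).det_pos,
    ← Real.exp_add, ← Real.exp_add, ← Real.exp_add]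
  ring_nf

theorem gaussBdd_sker (h : GoodCoeffs A b c a₀ A₀) :
    GaussBdd {x : ℝ × Ed d | |x.1| ≤ 1} (sker A b c) := by
  set S := {x : ℝ × Ed d | |x.1| ≤ 1}
  have hz : ∀ i, PolyBdd S (fun x y => (y - x.1 • b x.2) i) := fun i => by
    have h1 : PolyBdd S (fun (_ : ℝ × Ed d) (y : Ed d) => y i) :=
      PolyBdd.of_right (by fun_prop) (abs_coord_le · i)
    have h2 := h1.add ((PolyBdd.const S (-1)).mul (PolyBdd.fst.mul (h.polyBdd_b S i)))
    convert h2 using 3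
    simp
    ring
  have hq : PolyBdd S (fun x y => quadF (A x.2)⁻¹ (y - x.1 • b x.2)) :=
    PolyBdd.sum _ fun i => PolyBdd.sum _ fun j => ((hz i).mul (h.polyBdd_inv S i j)).mul (hz j)
  have hlog := h.polyBdd_comp_det S (g := Real.log)
    (Real.contDiffOn_log.mono fun x hx => (mem_Ioi.1 hx).ne')
  have hE := (((PolyBdd.const S ((-(d : ℝ) / 2) * Real.log (4 * Real.pi))).add
    ((PolyBdd.const S (-(1 : ℝ) / 2)).mul hlog)).add
    ((PolyBdd.const S (-1)).mul ((PolyBdd.fst.mul PolyBdd.fst).mul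
      (PolyBdd.of_snd (Y := Ed d) h.contDiffc h.bddc)))).add
    ((PolyBdd.const S (-(1 : ℝ) / 4)).mul hq)
  have hA₀ : 0 < A₀ := h.pos.trans_le h.le
  obtain ⟨Cc, hCc⟩ := h.bddc 0 (by norm_num)
  obtain ⟨Cb, hCb⟩ := h.bddb 0 (by norm_num)
  simp only [norm_iteratedFDeriv_zero] at hCc hCb
  have := PolyBdd.exp hE (a := A₀⁻¹ / 8) (by positivity)
    (C₀ := (-(d : ℝ) / 2) * Real.log (4 * Real.pi) + (-(1 : ℝ) / 2) * Real.log (a₀ ^ d) + Cc +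
      A₀⁻¹ / 4 * Cb ^ 2) fun x hx y => ?_
  · simpa only [← h.sker_eq_exp] using this
  · have e1 : Real.log (a₀ ^ d) ≤ Real.log (A x.2).det :=
      Real.log_le_log (pow_pos h.pos d)
        (pow_le_det_of_quadF_le (h.symm _) h.pos fun p => (h.ell _ p).1)
    have hx2 : x.1 * x.1 ≤ 1 := by
      have hx' : |x.1| ≤ 1 := hx
      have := abs_mul_abs_self x.1
      nlinarith [abs_nonneg x.1]
    have e2 : -(x.1 * x.1 * c x.2) ≤ Cc := by
      have h1 := hCc x.2
      rw [Real.norm_eq_abs] at h1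
      calc -(x.1 * x.1 * c x.2) ≤ |x.1 * x.1 * c x.2| := neg_le_abs _
        _ = (x.1 * x.1) * |c x.2| := by rw [abs_mul, abs_of_nonneg (mul_self_nonneg _)]
        _ ≤ 1 * Cc := mul_le_mul hx2 h1 (abs_nonneg _) zero_le_one
        _ = Cc := one_mul _
    have e3 := h.le_quadF_inv x.2 (y - x.1 • b x.2)
    have e4 : ‖y‖ ^ 2 ≤ 2 * ‖y - x.1 • b x.2‖ ^ 2 + 2 * Cb ^ 2 := by
      have h1 : ‖y‖ ≤ ‖y - x.1 • b x.2‖ + Cb := by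
        have h2 := norm_le_norm_sub_add y (x.1 • b x.2)
        rw [norm_smul (x.1)] at h2
        have h3 : ‖x.1‖ * ‖b x.2‖ ≤ 1 * Cb := mul_le_mul hx (hCb _) (norm_nonneg _) zero_le_one
        linarith
      nlinarith [norm_nonneg y, sq_nonneg (‖y - x.1 • b x.2‖ - Cb)]
    have e5 := mul_le_mul_of_nonneg_left e4 (inv_pos.2 hA₀).le
    linarith

end GoodCoeffs

end Kernel

section Moments

variable {d : ℕ} {A : Ed d → Matrix (Fin d) (Fin d) ℝ} {b : Ed d → Ed d} {c : Ed d → ℝ} {a₀ A₀ : ℝ}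

/-- Derivatives of integrals against a Gaussian-bounded kernel in arbitrary directions. -/
theorem GaussBdd.hasDerivAt_integral_of_lt {X Y : Type*} [NormedAddCommGroup X] [NormedSpace ℝ X]
    [NormedAddCommGroup Y] [NormedSpace ℝ Y] [FiniteDimensional ℝ Y] [MeasurableSpace Y]
    [BorelSpace Y] {μ : Measure Y} [μ.IsAddHaarMeasure]
    {u : ℝ × X → Y → ℝ} (hu : GaussBdd {x : ℝ × X | |x.1| ≤ 1} u)
    {x : ℝ × X} (hx : |x.1| < 1) (v w : ℝ × X) :
    (Integrable (fun y => fderiv ℝ (fun x => u x y) x v) μ ∧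
      HasDerivAt (fun r : ℝ => ∫ y, u (x + r • v) y ∂μ)
        (∫ y, fderiv ℝ (fun x => u x y) x v ∂μ) 0) ∧
    Integrable (fun y => fderiv ℝ (fderiv ℝ (fun x => u x y)) x v w) μ ∧
      HasDerivAt (fun r : ℝ => ∫ y, fderiv ℝ (fun x => u x y) (x + r • v) w ∂μ)
        (∫ y, fderiv ℝ (fderiv ℝ (fun x => u x y)) x v w ∂μ) 0 := by
  obtain ⟨δ, hδ, hδx⟩ : ∃ δ : ℝ, 0 < δ ∧ δ * |v.1| ≤ 1 - |x.1| :=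
    ⟨(1 - |x.1|) / (1 + |v.1|), by have := abs_nonneg v.1; apply div_pos <;> linarith, by
      have h0 := abs_nonneg v.1
      rw [div_mul_eq_mul_div, div_le_iff₀ (by positivity)]
      nlinarith⟩
  have hS : ∀ r : ℝ, |r| < 1 → x + r • (δ • v) ∈ {x : ℝ × X | |x.1| ≤ 1} := fun r hr => by
    have h1 : |r * (δ * v.1)| ≤ 1 * (δ * |v.1|) := by
      rw [abs_mul, abs_mul, abs_of_pos hδ]
      gcongr
    have h2 := abs_add_le x.1 (r * (δ * v.1))
    simp only [mem_ofPred_eq, Prod.fst_add, Prod.smul_fst, smul_eq_mul]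
    linarith
  obtain ⟨i1, d1⟩ := hu.hasDerivAt_integral (μ := μ) hS
  obtain ⟨i2, d2⟩ := hu.hasDerivAt_integral_fderiv (μ := μ) w hS
  simp only [map_smul, smul_apply, integral_smul] at i1 d1 i2 d2
  have hdiv : HasDerivAt (fun r : ℝ => δ⁻¹ * r) δ⁻¹ 0 := by
    simpa using (hasDerivAt_id (0 : ℝ)).const_mul δ⁻¹
  have hr : ∀ r : ℝ, (δ⁻¹ * r) • δ • v = r • v := fun r => by
    rw [smul_smul, mul_right_comm, inv_mul_cancel₀ hδ.ne', one_mul]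
  refine ⟨⟨?_, ?_⟩, ?_, ?_⟩
  · simpa [smul_eq_mul, hδ.ne'] using i1.const_mul δ⁻¹
  · have := HasDerivAt.comp_of_eq (0 : ℝ) d1 hdiv (by simp)
    simpa [Function.comp_def, hr, mul_right_comm _ _ δ⁻¹, hδ.ne'] using this
  · simpa [smul_eq_mul, hδ.ne'] using i2.const_mul δ⁻¹
  · have := HasDerivAt.comp_of_eq (0 : ℝ) d2 hdiv (by simp)
    simpa [Function.comp_def, hr, mul_right_comm _ _ δ⁻¹, hδ.ne'] using this

namespace GoodCoeffs

/-- Derivatives of the weighted kernel integrate to the derivatives of its moments. -/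
theorem moment_deriv (h : GoodCoeffs A b c a₀ A₀) {P : Ed d → ℝ} (hP : ContDiff ℝ 2 P) {B : ℝ}
    {n : ℕ} (hB : ∀ y, |P y| ≤ B * (1 + ‖y‖) ^ n) {m : ℝ × Ed d → ℝ} (hm : ContDiff ℝ 2 m)
    (hM : ∀ x, ∫ y, P y * sker A b c x y = m x) (q : Ed d) (v w : ℝ × Ed d) :
    (Integrable (fun y => P y * fderiv ℝ (fun x => sker A b c x y) (0, q) v) ∧
      ∫ y, P y * fderiv ℝ (fun x => sker A b c x y) (0, q) v = fderiv ℝ m (0, q) v) ∧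
    Integrable (fun y => P y * fderiv ℝ (fderiv ℝ (fun x => sker A b c x y)) (0, q) v w) ∧
      ∫ y, P y * fderiv ℝ (fderiv ℝ (fun x => sker A b c x y)) (0, q) v w =
        fderiv ℝ (fderiv ℝ m) (0, q) v w := by
  have hu := h.gaussBdd_sker.weight hP hB
  have hs : ∀ y, ContDiff ℝ 2 fun x => sker A b c x y := h.gaussBdd_sker.1.slice_left
  have e1 : ∀ y, fderiv ℝ (fun x => P y * sker A b c x y) =
      fun x => P y • fderiv ℝ (fun x => sker A b c x y) x := fun y => by
    ext1 x
    exact fderiv_const_mul ((hs y).differentiable (by norm_num) x) _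
  have e2 : ∀ y x, fderiv ℝ (fderiv ℝ (fun x => P y * sker A b c x y)) x =
      P y • fderiv ℝ (fderiv ℝ (fun x => sker A b c x y)) x := fun y x => by
    rw [e1]
    exact fderiv_const_smul (R := ℝ) (f := fderiv ℝ (fun x => sker A b c x y)) (((hs y).fderiv_right (m := 1) (by norm_num)).differentiable
      (by norm_num) x) _
  have d1 := fun (x : ℝ × Ed d) (hx : |x.1| < 1) (v w : ℝ × Ed d) =>
    hu.hasDerivAt_integral_of_lt (μ := volume) hx v w
  simp only [e2, hM] at d1
  simp only [e1, smul_apply, smul_eq_mul] at d1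
  have f1 : ∀ (x : ℝ × Ed d) (_ : |x.1| < 1) (v : ℝ × Ed d),
      ∫ y, P y * fderiv ℝ (fun x => sker A b c x y) x v = fderiv ℝ m x v := fun x hx v => by
    have k1 := hasDerivAt_comp_line (f := m) (p := x) (v := v) (s := 0)
      (hm.differentiable (by norm_num) _)
    rw [zero_smul, add_zero] at k1
    exact (d1 x hx v v).1.2.unique k1
  have h0 : |((0, q) : ℝ × Ed d).1| < 1 := by simp
  refine ⟨⟨(d1 _ h0 v w).1.1, f1 _ h0 v⟩, (d1 _ h0 v w).2.1, ?_⟩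
  have k2 := hasDerivAt_fderiv_comp_line (f := m) (p := (0, q)) (v := v) (s := 0) hm w
  rw [zero_smul, add_zero] at k2
  refine (d1 _ h0 v w).2.2.unique (k2.congr_of_eventuallyEq ?_)
  have hc : Continuous fun r : ℝ => |(((0, q) : ℝ × Ed d) + r • v).1| := by fun_prop
  filter_upwards [hc.continuousAt.eventually_lt (continuousAt_const (y := (1 : ℝ))) (by simp)]
    with r hr using f1 _ hr w

theorem integral_sker_shift (P : Ed d → ℝ) (x : ℝ × Ed d) :
    ∫ y, P y * sker A b c x y =
      Real.exp (-(x.1 ^ 2 * c x.2)) * ∫ y, P (y + x.1 • b x.2) * gdens (A x.2) y := by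
  rw [← integral_const_mul,
    ← integral_add_right_eq_self (fun y => P y * sker A b c x y) (x.1 • b x.2)]
  simp only [sker, add_sub_cancel_right]
  exact integral_congr_ae (Eventually.of_forall fun y => by ring)

theorem integrable_mul_gdens (h : GoodCoeffs A b c a₀ A₀) (q : Ed d) {P : Ed d → ℝ}
    (hP : Continuous P) {B : ℝ} {m : ℕ} (hB : ∀ y, |P y| ≤ B * (1 + ‖y‖) ^ m) :
    Integrable (fun y => P y * gdens (A q) y) :=
  _root_.integrable_mul_gdens (inv_pos.2 (h.pos.trans_le h.le)) (h.le_quadF_inv q) hP hB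

theorem moment_zero (h : GoodCoeffs A b c a₀ A₀) (x : ℝ × Ed d) :
    ∫ y, 1 * sker A b c x y = Real.exp (-(x.1 ^ 2 * c x.2)) := by
  rw [integral_sker_shift (fun _ => 1)]
  simp [integral_gdens (h.posDef x.2)]

theorem moment_one (h : GoodCoeffs A b c a₀ A₀) (i : Fin d) (x : ℝ × Ed d) :
    ∫ y : Ed d, y i * sker A b c x y = Real.exp (-(x.1 ^ 2 * c x.2)) * (x.1 * b x.2 i) := by
  rw [integral_sker_shift (fun y => y i)]
  have i0 := h.integrable_mul_gdens x.2 (P := fun _ => 1) (B := 1) (m := 0) continuous_const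
    (by simp)
  have i1 := h.integrable_mul_gdens x.2 (P := fun y => y i) (by fun_prop) (abs_coord_le · i)
  have e : ∀ y : Ed d, (y + x.1 • b x.2) i * gdens (A x.2) y =
      y i * gdens (A x.2) y + (x.1 * b x.2 i) * (1 * gdens (A x.2) y) := fun y => by
    simp; ring
  simp only [e]
  rw [integral_add i1 (i0.const_mul _), integral_const_mul, integral_coord_mul_gdens]
  simp [integral_gdens (h.posDef x.2)]

theorem moment_two (h : GoodCoeffs A b c a₀ A₀) (i j : Fin d) (x : ℝ × Ed d) :
    ∫ y : Ed d, (y i * y j) * sker A b c x y =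
      Real.exp (-(x.1 ^ 2 * c x.2)) * (2 * A x.2 i j + x.1 ^ 2 * b x.2 i * b x.2 j) := by
  rw [integral_sker_shift (fun y => y i * y j)]
  have i0 := h.integrable_mul_gdens x.2 (P := fun _ => 1) (B := 1) (m := 0) continuous_const
    (by simp)
  have i1 := fun i => h.integrable_mul_gdens x.2 (P := fun y => y i) (by fun_prop)
    (abs_coord_le · i)
  have i2 := h.integrable_mul_gdens x.2 (P := fun y => y i * y j) (by fun_prop)
    (abs_coord_mul_coord_le · i j)
  have e : ∀ y : Ed d, (y + x.1 • b x.2) i * (y + x.1 • b x.2) j * gdens (A x.2) y =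
      y i * y j * gdens (A x.2) y + (x.1 * b x.2 j) * (y i * gdens (A x.2) y) +
      (x.1 * b x.2 i) * (y j * gdens (A x.2) y) +
      (x.1 ^ 2 * b x.2 i * b x.2 j) * (1 * gdens (A x.2) y) := fun y => by
    simp; ring
  have k1 : Integrable fun y : Ed d =>
      y i * y j * gdens (A x.2) y + (x.1 * b x.2 j) * (y i * gdens (A x.2) y) :=
    i2.add ((i1 i).const_mul _)
  have k2 : Integrable fun y : Ed d =>
      y i * y j * gdens (A x.2) y + (x.1 * b x.2 j) * (y i * gdens (A x.2) y) +
      (x.1 * b x.2 i) * (y j * gdens (A x.2) y) := k1.add ((i1 j).const_mul _)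
  simp only [e]
  rw [integral_add k2 (i0.const_mul _), integral_add k1 ((i1 j).const_mul _),
    integral_add i2 ((i1 i).const_mul _), integral_const_mul, integral_const_mul,
    integral_const_mul, integral_coord_mul_gdens, integral_coord_mul_gdens,
    integral_coord_mul_coord_mul_gdens (h.posDef x.2) (h.symm _)
      (inv_pos.2 (h.pos.trans_le h.le)) (h.le_quadF_inv x.2)]
  simp [integral_gdens (h.posDef x.2)]

end GoodCoeffs

end Moments

section Expansion

variable {d : ℕ} {A : Ed d → Matrix (Fin d) (Fin d) ℝ} {b : Ed d → Ed d} {c : Ed d → ℝ} {a₀ A₀ : ℝ}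

theorem map_eq_sum_eb {V : Type*} [NormedAddCommGroup V] [NormedSpace ℝ V] (L : Ed d →L[ℝ] V)
    (y : Ed d) : L y = ∑ i, y i • L (eb i) := by
  have h := (EuclideanSpace.basisFun (Fin d) ℝ).sum_repr y
  conv_lhs => rw [← h]
  simp [eb]

theorem map_one_neg_smul {V : Type*} [NormedAddCommGroup V] [NormedSpace ℝ V]
    (L : ℝ × Ed d →L[ℝ] V) (σ : ℝ) (y : Ed d) :
    L (1, -(σ • y)) = L (1, 0) - σ • ∑ i, y i • L (0, eb i) := by
  have h1 := map_eq_sum_eb (L.comp (ContinuousLinearMap.inr ℝ ℝ (Ed d))) y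
  simp only [ContinuousLinearMap.comp_apply, ContinuousLinearMap.inr_apply] at h1
  rw [← h1, ← map_smul, ← map_sub]
  simp

theorem fderiv_zero_prod {m : ℝ × Ed d → ℝ} (hm : ContDiff ℝ 2 m) (q w : Ed d) :
    fderiv ℝ m (0, q) (0, w) = fderiv ℝ (fun q => m (0, q)) q w := by
  have h1 : HasFDerivAt (fun q : Ed d => ((0 : ℝ), q)) (ContinuousLinearMap.inr ℝ ℝ (Ed d)) q :=
    hasFDerivAt_prodMk_right 0 q
  have h2 := ((hm.differentiable (by norm_num) (0, q)).hasFDerivAt.comp q h1).fderiv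
  simp only [Function.comp_def] at h2
  rw [h2]
  simp

theorem fderiv_fst_eq {m : ℝ × Ed d → ℝ} (hm : ContDiff ℝ 2 m) (q : Ed d) {s m' : ℝ}
    (h : HasDerivAt (fun s => m (s, q)) m' s) : fderiv ℝ m (s, q) (1, 0) = m' := by
  have h1 : HasDerivAt (fun s : ℝ => (s, q)) ((1 : ℝ), (0 : Ed d)) s :=
    (hasDerivAt_id s).prodMk (hasDerivAt_const s q)
  exact ((hm.differentiable (by norm_num) (s, q)).hasFDerivAt.comp_hasDerivAt s h1).unique h

theorem fderiv_fderiv_zero_prod {m : ℝ × Ed d → ℝ} (hm : ContDiff ℝ 2 m) (q v : Ed d)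
    (w : ℝ × Ed d) : fderiv ℝ (fderiv ℝ m) (0, q) (0, v) w =
      fderiv ℝ (fun q => fderiv ℝ m (0, q) w) q v := by
  have h1 : HasFDerivAt (fun q : Ed d => ((0 : ℝ), q)) (ContinuousLinearMap.inr ℝ ℝ (Ed d)) q :=
    hasFDerivAt_prodMk_right 0 q
  have h2 : HasFDerivAt (fun x => fderiv ℝ m x w) _ (0, q) :=
    (((hm.fderiv_right (m := 1) (by norm_num)).differentiable
    (by norm_num) (0, q)).hasFDerivAt.clm_apply (hasFDerivAt_const w ((0 : ℝ), q)))
  have h3 := (h2.comp q h1).fderiv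
  simp only [Function.comp_def] at h3
  rw [h3]
  simp

/-- `f` is integrable with integral `I`. -/
def HasInt {V : Type*} [NormedAddCommGroup V] [NormedSpace ℝ V] (f : Ed d → V) (I : V) : Prop :=
  Integrable f ∧ ∫ y, f y = I

namespace HasInt

variable {V : Type*} [NormedAddCommGroup V] [NormedSpace ℝ V] {f g : Ed d → V} {I J : V}

theorem add (hf : HasInt f I) (hg : HasInt g J) : HasInt (fun y => f y + g y) (I + J) :=
  ⟨hf.1.add hg.1, by rw [integral_add hf.1 hg.1, hf.2, hg.2]⟩

theorem sum {f : Fin d → Ed d → V} {I : Fin d → V} (hf : ∀ i, HasInt (f i) (I i)) :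
    HasInt (fun y => ∑ i, f i y) (∑ i, I i) :=
  ⟨integrable_finsetSum _ fun i _ => (hf i).1, by
    rw [integral_finsetSum _ fun i _ => (hf i).1]
    exact Finset.sum_congr rfl fun i _ => (hf i).2⟩

theorem smul_const [CompleteSpace V] {f : Ed d → ℝ} {I : ℝ} (hf : HasInt f I) (v : V) :
    HasInt (fun y => f y • v) (I • v) :=
  ⟨hf.1.smul_const v, by rw [integral_smul_const, hf.2]⟩

theorem integral_eq (hf : HasInt f I) (hg : ∀ y, g y = f y) (hIJ : I = J) : ∫ y, g y = J := by
  simp only [hg, hf.2, hIJ]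

end HasInt

namespace GoodCoeffs

theorem contDiff_comp_snd {f : Ed d → ℝ} (hf : ContDiff ℝ 2 f) :
    ContDiff ℝ 2 fun x : ℝ × Ed d => f x.2 := hf.comp contDiff_snd

theorem contDiff_coord (h : GoodCoeffs A b c a₀ A₀) (i : Fin d) :
    ContDiff ℝ 2 fun q => b q i := by
  have := h.contDiffb
  fun_prop

theorem contDiff_exp (h : GoodCoeffs A b c a₀ A₀) :
    ContDiff ℝ 2 fun x : ℝ × Ed d => Real.exp (-(x.1 ^ 2 * c x.2)) :=
  ((contDiff_fst.pow 2).mul (contDiff_comp_snd h.contDiffc)).neg.exp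

theorem hasDerivAt_exp (q : Ed d) (s : ℝ) :
    HasDerivAt (fun s : ℝ => Real.exp (-(s ^ 2 * c q)))
      (Real.exp (-(s ^ 2 * c q)) * (-(2 * s * c q))) s := by
  have := ((hasDerivAt_pow 2 s).mul_const (c q)).neg.exp
  simpa using this

theorem hasInt_zero (h : GoodCoeffs A b c a₀ A₀) (q : Ed d) :
    HasInt (fun y => sker A b c (0, q) y) 1 ∧
    HasInt (fun y => fderiv ℝ (fun x => sker A b c x y) (0, q) (1, 0)) 0 ∧
    HasInt (fun y => fderiv ℝ (fderiv ℝ (fun x => sker A b c x y)) (0, q) (1, 0) (1, 0))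
      (-2 * c q) := by
  obtain ⟨⟨i1, e1⟩, i2, e2⟩ := h.moment_deriv (P := fun _ => 1) (B := 1) (n := 0) contDiff_const
    (by simp) h.contDiff_exp h.moment_zero q (1, 0) (1, 0)
  have e0 := h.moment_zero (0, q)
  have d1 : ∀ s, fderiv ℝ (fun x : ℝ × Ed d => Real.exp (-(x.1 ^ 2 * c x.2))) (s, q) (1, 0) =
      Real.exp (-(s ^ 2 * c q)) * (-(2 * s * c q)) := fun s =>
    fderiv_fst_eq h.contDiff_exp q (hasDerivAt_exp q s)
  have d2 := hasDerivAt_fderiv_comp_line h.contDiff_exp (0, q) (1, 0) (1, 0) 0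
  simp only [Prod.smul_mk, smul_eq_mul, mul_one, smul_zero, Prod.mk_add_mk, zero_add, add_zero,
    d1] at d2
  have d3 : HasDerivAt (fun s => Real.exp (-(s ^ 2 * c q)) * (-(2 * s * c q))) (-2 * c q) 0 := by
    have := (hasDerivAt_exp (c := c) q 0).mul
      (((hasDerivAt_id (0 : ℝ)).const_mul 2).mul_const (c q)).neg
    exact this.congr_deriv (by simp)
  simp only [one_mul] at i1 e1 i2 e2 e0
  refine ⟨⟨?_, by simpa using e0⟩, ⟨i1, by rw [e1, d1]; simp⟩, i2, by rw [e2, d2.unique d3]⟩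
  exact integrable_of_integral_eq_one (by simpa using e0)

theorem hasInt_one (h : GoodCoeffs A b c a₀ A₀) (q : Ed d) (i j : Fin d) :
    HasInt (fun y => y i * fderiv ℝ (fun x => sker A b c x y) (0, q) (1, 0)) (b q i) ∧
    HasInt (fun y => y i * fderiv ℝ (fun x => sker A b c x y) (0, q) (0, eb j)) 0 ∧
    HasInt (fun y => y i * fderiv ℝ (fderiv ℝ (fun x => sker A b c x y)) (0, q) (0, eb j) (1, 0))
      (fderiv ℝ (fun x => b x i) q (eb j)) ∧
    HasInt (fun y => y i * fderiv ℝ (fderiv ℝ (fun x => sker A b c x y)) (0, q) (1, 0) (0, eb j))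
      (fderiv ℝ (fun x => b x i) q (eb j)) := by
  have hm : ContDiff ℝ 2 fun x : ℝ × Ed d => Real.exp (-(x.1 ^ 2 * c x.2)) * (x.1 * b x.2 i) :=
    h.contDiff_exp.mul (contDiff_fst.mul (contDiff_comp_snd (h.contDiff_coord i)))
  have H := h.moment_deriv (P := fun y => y i) (by fun_prop) (abs_coord_le · i) hm
    (h.moment_one i) q
  obtain ⟨⟨i1, e1⟩, i2, e2⟩ := H (1, 0) (0, eb j)
  obtain ⟨⟨i3, e3⟩, i4, e4⟩ := H (0, eb j) (1, 0)
  have d1 : ∀ q, fderiv ℝ (fun x : ℝ × Ed d => Real.exp (-(x.1 ^ 2 * c x.2)) * (x.1 * b x.2 i))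
      (0, q) (1, 0) = b q i := fun q =>
    fderiv_fst_eq hm q (((hasDerivAt_exp (c := c) q 0).mul
      ((hasDerivAt_id (0 : ℝ)).mul_const (b q i))).congr_deriv (by simp))
  have d2 := fderiv_fderiv_zero_prod hm q (eb j) (1, 0)
  simp only [d1] at d2
  refine ⟨⟨i1, by rw [e1, d1]⟩, ⟨i3, by rw [e3, fderiv_zero_prod hm]; simp⟩,
    ⟨i4, by rw [e4, d2]⟩, i2, ?_⟩
  rw [e2, ← d2]
  exact (hm.contDiffAt.isSymmSndFDerivAt (by simp)) _ _

theorem hasInt_coord (h : GoodCoeffs A b c a₀ A₀) (q : Ed d) (i : Fin d) :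
    HasInt (fun y => y i * sker A b c (0, q) y) 0 := by
  refine ⟨?_, by rw [h.moment_one]; simp⟩
  simpa [sker] using h.integrable_mul_gdens q (P := fun y => y i) (by fun_prop) (abs_coord_le · i)

theorem hasInt_two (h : GoodCoeffs A b c a₀ A₀) (q : Ed d) (i j : Fin d) (v w : Ed d) :
    HasInt (fun y => (y i * y j) * sker A b c (0, q) y) (2 * A q i j) ∧
    HasInt (fun y => (y i * y j) * fderiv ℝ (fun x => sker A b c x y) (0, q) (0, v))
      (2 * fderiv ℝ (fun x => A x i j) q v) ∧
    HasInt (fun y => (y i * y j) *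
        fderiv ℝ (fderiv ℝ (fun x => sker A b c x y)) (0, q) (0, v) (0, w))
      (2 * fderiv ℝ (fun x => fderiv ℝ (fun x => A x i j) x w) q v) := by
  have hm : ContDiff ℝ 2 fun x : ℝ × Ed d => Real.exp (-(x.1 ^ 2 * c x.2)) *
      (2 * A x.2 i j + x.1 ^ 2 * b x.2 i * b x.2 j) :=
    h.contDiff_exp.mul ((contDiff_const.mul (contDiff_comp_snd (h.contDiffA i j))).add
      (((contDiff_fst.pow 2).mul (contDiff_comp_snd (h.contDiff_coord i))).mul
        (contDiff_comp_snd (h.contDiff_coord j))))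
  obtain ⟨⟨i1, e1⟩, i2, e2⟩ := h.moment_deriv (P := fun y => y i * y j) (by fun_prop)
    (abs_coord_mul_coord_le · i j) hm (h.moment_two i j) q (0, v) (0, w)
  have d1 : ∀ q w, fderiv ℝ (fun x : ℝ × Ed d => Real.exp (-(x.1 ^ 2 * c x.2)) *
      (2 * A x.2 i j + x.1 ^ 2 * b x.2 i * b x.2 j)) (0, q) (0, w) =
        2 * fderiv ℝ (fun x => A x i j) q w := fun q w => by
    rw [fderiv_zero_prod hm]
    simp only [ne_eq, OfNat.ofNat_ne_zero, not_false_eq_true, zero_pow, zero_mul, neg_zero,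
      Real.exp_zero, one_mul, add_zero]
    rw [fderiv_const_mul ((h.contDiffA i j).differentiable (by norm_num) q)]
    simp
  refine ⟨⟨?_, by rw [h.moment_two]; simp⟩, ⟨i1, by rw [e1, d1]⟩, i2, ?_⟩
  · simpa [sker] using h.integrable_mul_gdens q (P := fun y => y i * y j) (by fun_prop)
      (abs_coord_mul_coord_le · i j)
  · rw [e2, fderiv_fderiv_zero_prod hm]
    simp only [d1]
    have := ((h.contDiffA i j).fderiv_right (m := 1) (by norm_num)).differentiable (by norm_num)
    rw [fderiv_const_mul (by fun_prop)]
    simp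

theorem integral_shiftInt_zero (h : GoodCoeffs A b c a₀ A₀) (φ : Ed d → ℂ) (σ : ℝ) (q : Ed d) :
    ∫ y, shiftInt (sker A b c) φ σ 0 q y = φ q :=
  ((h.hasInt_zero q).1.smul_const (φ q)).integral_eq (fun y => by simp [shiftInt]) (by simp)

theorem integral_shiftInt₁_zero (h : GoodCoeffs A b c a₀ A₀) (φ : Ed d → ℂ) (σ : ℝ)
    (q : Ed d) : ∫ y, shiftInt₁ (sker A b c) φ σ 0 q y = 0 := by
  refine (((HasInt.sum fun i => (h.hasInt_coord q i).smul_const (-fderiv ℝ φ q (eb i))).add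
    ((h.hasInt_zero q).2.1.smul_const (φ q))).add
      (HasInt.sum fun i => (h.hasInt_one q i i).2.1.smul_const (-(σ • φ q)))).integral_eq
    (fun y => ?_) (by simp)
  simp only [shiftInt₁, zero_smul, add_zero, map_one_neg_smul, map_neg]
  rw [map_eq_sum_eb (fderiv ℝ φ q) y, ← Finset.sum_neg_distrib, Finset.smul_sum, sub_smul,
    sub_eq_add_neg, ← add_assoc]
  congr 2
  · exact Finset.sum_congr rfl fun i _ => by module
  · rw [← neg_smul, ← smul_neg, smul_assoc, smul_comm, ← Finset.sum_neg_distrib,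
      Finset.sum_smul]
    refine Finset.sum_congr rfl fun i _ => ?_
    simp only [smul_eq_mul]
    module

theorem integral_shiftInt₂_zero (h : GoodCoeffs A b c a₀ A₀) {φ : Ed d → ℂ}
    (hφ : ContDiff ℝ 2 φ) (τ : ℝ) (q : Ed d) :
    ∫ y, shiftInt₂ (sker A b c) φ (1 - τ) 0 q y = 2 * -(Ltau A b c τ φ q) := by
  set σ := 1 - τ with hσ
  have hφ' : ∀ i j, fderiv ℝ (fun x => fderiv ℝ φ x (eb j)) q (eb i) =
      fderiv ℝ (fderiv ℝ φ) q (eb i) (eb j) := fun i j => by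
    have := (hφ.fderiv_right (m := 1) (by norm_num)).differentiable (by norm_num)
    rw [fderiv_clm_apply (this q) (by fun_prop)]
    simp
  refine (((((((HasInt.sum fun i => HasInt.sum fun j =>
      (h.hasInt_two q i j 0 0).1.smul_const (fderiv ℝ (fderiv ℝ φ) q (eb i) (eb j))).add
    (HasInt.sum fun i => (h.hasInt_one q i i).1.smul_const (-((2 : ℝ) • fderiv ℝ φ q (eb i))))).add
    (HasInt.sum fun i => HasInt.sum fun j => (h.hasInt_two q i j (eb j) 0).2.1.smul_const
      ((2 * σ) • fderiv ℝ φ q (eb i)))).add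
    ((h.hasInt_zero q).2.2.smul_const (φ q))).add
    (HasInt.sum fun i => (h.hasInt_one q i i).2.2.1.smul_const (-(σ • φ q)))).add
    (HasInt.sum fun i => (h.hasInt_one q i i).2.2.2.smul_const (-(σ • φ q)))).add
    (HasInt.sum fun i => HasInt.sum fun j => (h.hasInt_two q i j (eb i) (eb j)).2.2.smul_const
      (σ ^ 2 • φ q))).integral_eq (fun y => ?_) ?_
  · simp only [shiftInt₂, zero_smul, add_zero]
    have e1 : fderiv ℝ (fderiv ℝ φ) q (-y) (-y) =
        ∑ i, ∑ j, (y i * y j) • fderiv ℝ (fderiv ℝ φ) q (eb i) (eb j) := by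
      rw [map_neg, map_neg, neg_apply, neg_neg,
        map_eq_sum_eb (fderiv ℝ (fderiv ℝ φ) q) y, sum_apply]
      refine Finset.sum_congr rfl fun i _ => ?_
      rw [smul_apply, map_eq_sum_eb _ y, Finset.smul_sum]
      exact Finset.sum_congr rfl fun j _ => smul_smul _ _ _
    have e2 : fderiv ℝ φ q (-y) = -∑ i, y i • fderiv ℝ φ q (eb i) := by
      rw [map_neg, map_eq_sum_eb (fderiv ℝ φ q) y]
    have e3 := map_one_neg_smul (fderiv ℝ (fun x => sker A b c x y) (0, q)) σ y
    have e4 := map_one_neg_smul (fderiv ℝ (fderiv ℝ (fun x => sker A b c x y)) (0, q)) σ y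
    have e5 : fderiv ℝ (fderiv ℝ (fun x => sker A b c x y)) (0, q) (1, -(σ • y)) (1, -(σ • y)) =
        fderiv ℝ (fderiv ℝ (fun x => sker A b c x y)) (0, q) (1, 0) (1, 0) -
        σ * ∑ i, y i * fderiv ℝ (fderiv ℝ (fun x => sker A b c x y)) (0, q) (1, 0) (0, eb i) -
        σ * ∑ i, y i * (fderiv ℝ (fderiv ℝ (fun x => sker A b c x y)) (0, q) (0, eb i) (1, 0) -
          σ * ∑ j, y j *
            fderiv ℝ (fderiv ℝ (fun x => sker A b c x y)) (0, q) (0, eb i) (0, eb j)) := by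
      rw [e4]
      simp only [sub_apply, smul_apply, sum_apply, map_one_neg_smul, smul_eq_mul]
    simp only [smul_eq_mul] at e3
    rw [e1, e2, e3, e5]
    simp only [Complex.real_smul]
    push_cast
    simp only [Finset.mul_sum, Finset.sum_mul, mul_sub, sub_mul, mul_neg, Finset.sum_sub_distrib,
      Finset.sum_neg_distrib]
    ring_nf
    simp only [mul_comm, mul_left_comm, mul_assoc]
    ring
  · simp only [Ltau, hφ', ← hσ]
    simp only [Complex.real_smul]
    push_cast
    simp only [Finset.mul_sum, Finset.sum_mul, mul_sub, sub_mul, mul_neg, Finset.sum_sub_distrib,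
      Finset.sum_neg_distrib, neg_mul, mul_add, add_mul]
    ring_nf
    simp only [mul_comm, mul_left_comm, mul_assoc]
    ring_nf
    simp only [← Finset.sum_mul]
    ring

end GoodCoeffs

end Expansion

section Main

variable {d : ℕ} {A : Ed d → Matrix (Fin d) (Fin d) ℝ} {b : Ed d → Ed d} {c : Ed d → ℝ} {a₀ A₀ : ℝ}

theorem pow_mul_gker {s : ℝ} (hs : 0 < s) (x y : Ed d) :
    s ^ d * gker A b c (s ^ 2) x (s • y) = sker A b c (s, x) y := by
  have h1 : s • y - s ^ 2 • b x = s • (y - s • b x) := by module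
  have h2 : (s ^ 2) ^ (-(d : ℝ) / 2) = (s ^ d)⁻¹ := by
    rw [← Real.rpow_natCast, ← Real.rpow_mul hs.le, ← Real.rpow_natCast, ← Real.rpow_neg hs.le]
    congr 1
    push_cast
    ring
  have h3 : -(s ^ 2 * quadF (A x)⁻¹ (y - s • b x)) / (4 * s ^ 2) =
      -quadF (A x)⁻¹ (y - s • b x) / 4 := by
    field_simp
  rw [gker, sker, gdens, h1, quadF_smul, h3, Real.mul_rpow (by positivity) (by positivity), h2]
  field_simp

theorem integral_gker_eq {s : ℝ} (hs : 0 < s) (τ : ℝ) (φ : Ed d → ℂ) (q : Ed d) :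
    ∫ q₁, ((gker A b c (s ^ 2) (τ • q + (1 - τ) • q₁) (q - q₁) : ℝ) : ℂ) * φ q₁ =
      ∫ y, shiftInt (sker A b c) φ (1 - τ) s q y := by
  have h1 := integral_sub_left_eq_self (fun z : Ed d =>
    ((gker A b c (s ^ 2) (q - (1 - τ) • z) z : ℝ) : ℂ) * φ (q - z)) volume q
  have h2 := Measure.integral_comp_smul (volume : Measure (Ed d)) (fun z : Ed d =>
    ((gker A b c (s ^ 2) (q - (1 - τ) • z) z : ℝ) : ℂ) * φ (q - z)) s
  have h3 : ∀ y, shiftInt (sker A b c) φ (1 - τ) s q y = ((s ^ d : ℝ) : ℂ) *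
      (((gker A b c (s ^ 2) (q - (1 - τ) • s • y) (s • y) : ℝ) : ℂ) * φ (q - s • y)) := fun y => by
    rw [← mul_assoc, ← Complex.ofReal_mul, pow_mul_gker hs, shiftInt, Complex.real_smul]
    congr 4
    · ext1
      · simp
      · simp only [Prod.snd_add, Prod.smul_snd]
        module
    · simp [sub_eq_add_neg]
  have h4 : ∀ q₁ : Ed d, q - (1 - τ) • (q - q₁) = τ • q + (1 - τ) • q₁ := fun q₁ => by module
  simp only [sub_sub_cancel, h4] at h1
  simp only [h3]
  rw [integral_const_mul, h2, h1, finrank_euclideanSpace_fin, abs_of_pos (by positivity),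
    Complex.real_smul, ← mul_assoc, ← Complex.ofReal_mul, mul_inv_cancel₀ (by positivity)]
  simp

theorem GoodCoeffs.tendsto_integral_gker (h : GoodCoeffs A b c a₀ A₀) {τ : ℝ}
    (hτ : τ ∈ Icc (0 : ℝ) 1) {φ : Ed d → ℂ} (hφ : ContDiff ℝ 2 φ) (hc : HasCompactSupport φ) :
    Tendsto (fun t : ℝ => ∫ q, ‖t⁻¹ • ((∫ q₁, ((gker A b c t (τ • q + (1 - τ) • q₁) (q - q₁) : ℝ) :
      ℂ) * φ q₁) - φ q) - -(Ltau A b c τ φ q)‖) (𝓝[>] 0) (𝓝 0) := by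
  have h1 := tendsto_integral_norm_shiftInt (μ := volume) h.gaussBdd_sker hφ hc (σ := 1 - τ)
    (abs_le.2 ⟨by linarith [hτ.2], by linarith [hτ.1]⟩) (h.integral_shiftInt_zero φ (1 - τ))
    (h.integral_shiftInt₁_zero φ (1 - τ)) (h.integral_shiftInt₂_zero hφ τ)
  have h2 : Tendsto Real.sqrt (𝓝[>] 0) (𝓝[>] 0) := by
    refine tendsto_nhdsWithin_iff.2 ⟨?_, ?_⟩
    · simpa using (Real.continuous_sqrt.tendsto 0).mono_left nhdsWithin_le_nhds
    · filter_upwards [self_mem_nhdsWithin] with t ht using Real.sqrt_pos.2 ht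
  refine (h1.comp h2).congr' ?_
  filter_upwards [self_mem_nhdsWithin] with t ht
  have h3 := integral_gker_eq (A := A) (b := b) (c := c) (Real.sqrt_pos.2 ht) τ φ
  rw [Real.sq_sqrt (le_of_lt ht)] at h3
  simp only [Function.comp, h3, Real.sq_sqrt (le_of_lt ht)]

theorem dense_of_mem_iff_contDiff {S : Set (L1sp d)}
    (hS : ∀ f : L1sp d, f ∈ S ↔ ∃ φ : Ed d → ℂ,
      ContDiff ℝ (⊤ : ℕ∞) φ ∧ HasCompactSupport φ ∧ (f : Ed d → ℂ) =ᵐ[volume] φ) :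
    Dense S := by
  have h := Lp.dense_hasCompactSupport_contDiff (E := Ed d) (F := ℂ) (p := 1)
    (μ := volume) (by norm_num)
  refine h.mono fun f hf => ?_
  obtain ⟨g, hg, hc, hd⟩ := hf
  exact (hS f).2 ⟨g, hd, hc, hg⟩

end Main

/-- **Lagrangian Feynman formula for the τ-quantization of
`h(q,p) = c(q) + i b(q)·p + p·A(q)p`**: the family `(F_τ(t))` of integral operators with
Gaussian kernels `g_t^{τq+(1−τ)q₁}(q−q₁)` is Chernoff equivalent to the semigroup `(T_t)`
generated by the closure of `−L^τ` on `C_c^∞(ℝ^d) ⊆ L¹(ℝ^d)`: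
`(F_τ(t/n))^n f → T_t f` in `L¹`, uniformly in `t ∈ [0,t₀]`. -/
theorem statement12 {d : ℕ} (hd : 1 ≤ d) (τ : ℝ) (hτ : τ ∈ Set.Icc (0 : ℝ) 1)
    (A : Ed d → Matrix (Fin d) (Fin d) ℝ) (hAsymm : ∀ q, (A q).IsSymm)
    (b : Ed d → Ed d) (c : Ed d → ℝ)
    (hA4 : ∀ i j, ContDiff ℝ 4 (fun q : Ed d => A q i j))
    (hA4b : ∀ i j, ∀ n : ℕ, n ≤ 4 →
      ∃ C : ℝ, ∀ q : Ed d, ‖iteratedFDeriv ℝ n (fun q : Ed d => A q i j) q‖ ≤ C)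
    (hb4 : ContDiff ℝ 4 b)
    (hb4b : ∀ n : ℕ, n ≤ 4 → ∃ C : ℝ, ∀ q : Ed d, ‖iteratedFDeriv ℝ n b q‖ ≤ C)
    (hc4 : ContDiff ℝ 4 c)
    (hc4b : ∀ n : ℕ, n ≤ 4 → ∃ C : ℝ, ∀ q : Ed d, ‖iteratedFDeriv ℝ n c q‖ ≤ C)
    (a₀ A₀ : ℝ) (ha₀ : 0 < a₀) (ha₀A₀ : a₀ ≤ A₀)
    (hell : ∀ q p : Ed d, a₀ * ‖p‖ ^ 2 ≤ quadF (A q) p ∧ quadF (A q) p ≤ A₀ * ‖p‖ ^ 2)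
    (k : ℝ) (hk : 0 ≤ k)
    (Fop : ℝ → L1sp d →L[ℝ] L1sp d)
    (hFop0 : Fop 0 = ContinuousLinearMap.id ℝ (L1sp d))
    (hFopRep : ∀ t : ℝ, 0 < t → ∀ f : L1sp d, ∀ᵐ q : Ed d ∂volume,
      Fop t f q = ∫ q₁ : Ed d, ((gker A b c t (τ • q + (1 - τ) • q₁) (q - q₁) : ℝ) : ℂ) * f q₁)
    (hFopNorm : ∀ t : ℝ, 0 ≤ t → ∀ f : L1sp d, ‖Fop t f‖ ≤ Real.exp (k * t) * ‖f‖)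
    (L0 : L1sp d →ₗ.[ℝ] L1sp d)
    (hdom : ∀ f : L1sp d, f ∈ L0.domain ↔ ∃ φ : Ed d → ℂ,
      ContDiff ℝ (⊤ : ℕ∞) φ ∧ HasCompactSupport φ ∧ (f : Ed d → ℂ) =ᵐ[volume] φ)
    (hL0 : ∀ f : L0.domain, ∀ φ : Ed d → ℂ, ContDiff ℝ (⊤ : ℕ∞) φ → HasCompactSupport φ →
      ((f : L1sp d) : Ed d → ℂ) =ᵐ[volume] φ →
      (L0 f : Ed d → ℂ) =ᵐ[volume] fun q : Ed d => -(Ltau A b c τ φ q))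
    (hclosable : L0.IsClosable)
    (T : ℝ → L1sp d →L[ℝ] L1sp d)
    (hT0 : T 0 = ContinuousLinearMap.id ℝ (L1sp d))
    (hTsemi : ∀ s t : ℝ, 0 ≤ s → 0 ≤ t → T (s + t) = (T s).comp (T t))
    (hTcont : ∀ f : L1sp d, ContinuousOn (fun t : ℝ => T t f) (Ici 0))
    (hgen_dom : ∀ f : L1sp d, f ∈ L0.closure.domain ↔
      ∃ y : L1sp d, Tendsto (fun t : ℝ => t⁻¹ • (T t f - f)) (𝓝[>] 0) (𝓝 y))
    (hgen : ∀ f : L0.closure.domain,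
      Tendsto (fun t : ℝ => t⁻¹ • (T t (f : L1sp d) - (f : L1sp d))) (𝓝[>] 0)
        (𝓝 (L0.closure f)))
    (f : L1sp d) (t₀ : ℝ) (ht₀ : 0 < t₀) :
    TendstoUniformlyOn (fun (n : ℕ) (t : ℝ) => ((Fop (t / n)) ^ n) f)
      (fun t : ℝ => T t f) atTop (Icc 0 t₀) := by
  have h : GoodCoeffs A b c a₀ A₀ :=
    { symm := hAsymm
      contDiffA := fun i j => (hA4 i j).of_le (by norm_num)
      bddA := fun i j n hn => hA4b i j n (hn.trans (by norm_num))
      contDiffb := hb4.of_le (by norm_num)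
      bddb := fun n hn => hb4b n (hn.trans (by norm_num))
      contDiffc := hc4.of_le (by norm_num)
      bddc := fun n hn => hc4b n (hn.trans (by norm_num))
      pos := ha₀
      le := ha₀A₀
      ell := hell }
  refine chernoff hk hFop0 hFopNorm hclosable (dense_of_mem_iff_contDiff hdom) (fun v => ?_) hT0
    hTsemi hTcont hgen_dom hgen f ht₀
  obtain ⟨φ, hφ, hc, hv⟩ := (hdom v).1 v.2
  rw [tendsto_iff_norm_sub_tendsto_zero]
  refine (h.tendsto_integral_gker hτ (contDiff_infty.1 hφ 2) hc).congr' ?_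
  filter_upwards [self_mem_nhdsWithin] with t ht
  rw [L1.norm_eq_integral_norm]
  refine integral_congr_ae ?_
  filter_upwards [Lp.coeFn_sub (t⁻¹ • (Fop t (v : L1sp d) - (v : L1sp d))) (L0 v),
    Lp.coeFn_smul t⁻¹ (Fop t (v : L1sp d) - (v : L1sp d)),
    Lp.coeFn_sub (Fop t (v : L1sp d)) (v : L1sp d), hFopRep t ht v, hL0 v φ hφ hc hv, hv]
    with q h1 h2 h3 h4 h5 h6
  have h7 : ∫ q₁ : Ed d, ((gker A b c t (τ • q + (1 - τ) • q₁) (q - q₁) : ℝ) : ℂ) *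
      (v : L1sp d) q₁ =
      ∫ q₁ : Ed d, ((gker A b c t (τ • q + (1 - τ) • q₁) (q - q₁) : ℝ) : ℂ) * φ q₁ := by
    refine integral_congr_ae ?_
    filter_upwards [hv] with q₁ hq₁
    rw [hq₁]
  rw [h1, Pi.sub_apply, h2, Pi.smul_apply, h3, Pi.sub_apply, h4, h5, h6, h7]
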